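/- arXiv:2108.02364 — 4 statements merged into one kernel-verified Lean document; each statement's English description precedes it below -/
import Mathlib

section
/- Let 2 ≤ s ≤ t and N be fixed integers. There exists n₀ such that for all n ≥ n₀ the following holds: with G⋆ and K as in the extremal setup, let H be the disjoint union of some collection of connected components of G⋆ − K with |V(H)| ≤ N, and let H′ be a graph on the vertex set V(H) having the (s,t)-property with e(H′) = e(H). Then Σ_{uv∈E(H′)} (d_H(u)+d_H(v)) ≤ Σ_{uv∈E(H)} (d_H(u)+d_H(v)); and if equality holds here, then moreover Σ_{uv∈E(H′)} (d_{H′}(u)+d_{H′}(v)) ≤ Σ_{uv∈E(H)} (d_H(u)+d_H(v)). -/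
open SimpleGraph

/-- `H` is a minor of `G` (branch-set definition). -/
def MinorOf {α β : Type} (H : SimpleGraph α) (G : SimpleGraph β) : Prop :=
  ∃ φ : α → Set β,
    (∀ a, (G.induce (φ a)).Connected) ∧
    (Pairwise fun a b => Disjoint (φ a) (φ b)) ∧
    (∀ a b, H.Adj a b → ∃ x ∈ φ a, ∃ y ∈ φ b, G.Adj x y)

/-- Adjacency matrix over ℝ. -/
noncomputable def adjMat {V : Type} [Fintype V] (G : SimpleGraph V) : Matrix V V ℝ :=
  letI := Classical.decRel G.Adj
  SimpleGraph.adjMatrix ℝ G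

theorem adjMat_herm {V : Type} [Fintype V] (G : SimpleGraph V) : (adjMat G).IsHermitian := by
  letI := Classical.decRel G.Adj
  ext i j
  simp [adjMat, Matrix.conjTranspose_apply, SimpleGraph.adjMatrix_apply, SimpleGraph.adj_comm]

/-- Spectral radius = largest adjacency eigenvalue. -/
noncomputable def specRad {V : Type} [Fintype V] [DecidableEq V] (G : SimpleGraph V) : ℝ :=
  ⨆ i, (adjMat_herm G).eigenvalues i

/-- degree -/
noncomputable def deg {V : Type} (G : SimpleGraph V) (v : V) : ℕ := (G.neighborSet v).ncard

/-- number of edges -/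
noncomputable def ecard {V : Type} (G : SimpleGraph V) : ℕ := G.edgeSet.ncard

/-- k disjoint copies of G -/
def copies (k : ℕ) {V : Type} (G : SimpleGraph V) : SimpleGraph (Fin k × V) :=
  SimpleGraph.fromRel fun x y => x.1 = y.1 ∧ G.Adj x.2 y.2

/-- disjoint union -/
def gUnion {V W : Type} (G : SimpleGraph V) (H : SimpleGraph W) : SimpleGraph (V ⊕ W) :=
  SimpleGraph.fromRel fun x y =>
    (∃ a b, x = Sum.inl a ∧ y = Sum.inl b ∧ G.Adj a b) ∨
    (∃ a b, x = Sum.inr a ∧ y = Sum.inr b ∧ H.Adj a b)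

/-- join -/
def gJoin {V W : Type} (G : SimpleGraph V) (H : SimpleGraph W) : SimpleGraph (V ⊕ W) :=
  SimpleGraph.fromRel fun x y =>
    (∃ a b, x = Sum.inl a ∧ y = Sum.inl b ∧ G.Adj a b) ∨
    (∃ a b, x = Sum.inr a ∧ y = Sum.inr b ∧ H.Adj a b) ∨
    (∃ a b, x = Sum.inl a ∧ y = Sum.inr b)

/-- Petersen graph (Kneser graph K(5,2)). -/
def petersen : SimpleGraph {s : Finset (Fin 5) // s.card = 2} :=
  SimpleGraph.fromRel fun a b => Disjoint a.1 b.1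

/-- star K_{1,m} -/
def starG (m : ℕ) : SimpleGraph (Fin 1 ⊕ Fin m) := completeBipartiteGraph (Fin 1) (Fin m)

/-- the star forest H_{s,t} -/
def Hst (s t : ℕ) :
    SimpleGraph ((Fin ((t+1)/(s+1) - 1) × (Fin 1 ⊕ Fin s)) ⊕ (Fin 1 ⊕ Fin (t - ((t+1)/(s+1) - 1) * (s+1)))) :=
  gUnion (copies ((t+1)/(s+1) - 1) (starG s)) (starG (t - ((t+1)/(s+1) - 1) * (s+1)))

/-- subdivide the edge uv of G by a path through k new vertices -/
def subdividePath {V : Type} (G : SimpleGraph V) (u v : V) (k : ℕ) : SimpleGraph (V ⊕ Fin k) :=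
  SimpleGraph.fromRel fun x y =>
    (∃ a b, x = Sum.inl a ∧ y = Sum.inl b ∧ G.Adj a b ∧ ¬(a = u ∧ b = v) ∧ ¬(a = v ∧ b = u)) ∨
    (∃ i : Fin k, x = Sum.inl u ∧ y = Sum.inr i ∧ (i : ℕ) = 0) ∨
    (∃ i j : Fin k, x = Sum.inr i ∧ y = Sum.inr j ∧ (j : ℕ) = (i : ℕ) + 1) ∨
    (∃ i : Fin k, x = Sum.inr i ∧ y = Sum.inl v ∧ (i : ℕ) = k - 1)

/-- (s,t)-property -/
def HasSTProp (s t : ℕ) {V : Type} (G : SimpleGraph V) : Prop :=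
  ∀ a b : ℕ, 1 ≤ a → 1 ≤ b → a + b = t + 1 → a ≤ min s ((t+1)/2) →
    ¬ MinorOf (completeBipartiteGraph (Fin a) (Fin b)) G

/-- H_{a,b,c} -/
def Habc (a b c : ℕ) : SimpleGraph (Fin 3 ⊕ (Fin a ⊕ Fin b ⊕ Fin c)) :=
  SimpleGraph.fromRel fun x y =>
    (x = Sum.inl 0 ∧ y = Sum.inl 1) ∨
    (x = Sum.inl 0 ∧ ∃ i : Fin a, y = Sum.inr (Sum.inl i)) ∨
    (x = Sum.inl 0 ∧ ∃ i : Fin b, y = Sum.inr (Sum.inr (Sum.inl i))) ∨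
    (x = Sum.inl 1 ∧ ∃ i : Fin a, y = Sum.inr (Sum.inl i)) ∨
    (x = Sum.inl 1 ∧ ∃ i : Fin c, y = Sum.inr (Sum.inr (Sum.inr i))) ∨
    (x = Sum.inl 2 ∧ ∃ i : Fin b, y = Sum.inr (Sum.inr (Sum.inl i))) ∨
    (x = Sum.inl 2 ∧ ∃ i : Fin c, y = Sum.inr (Sum.inr (Sum.inr i)))

noncomputable def edgeDegSum {V : Type} (G H : SimpleGraph V) : ℕ :=
  ∑ᶠ e ∈ G.edgeSet, Sym2.lift ⟨fun u v => deg H u + deg H v, fun u v => by dsimp; ring⟩ e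

lemma psd_of_specRad {V : Type} [Fintype V] [DecidableEq V] (G : SimpleGraph V) :
    (algebraMap ℝ (Matrix V V ℝ) (specRad G) - adjMat G).PosSemidef := by
  have hH : (algebraMap ℝ (Matrix V V ℝ) (specRad G) - adjMat G).IsHermitian := by
    apply Matrix.IsHermitian.sub _ (adjMat_herm G)
    ext i j
    simp [Matrix.algebraMap_matrix_apply, Matrix.conjTranspose_apply, eq_comm]
  rw [hH.posSemidef_iff_eigenvalues_nonneg]
  intro i
  have h := hH.eigenvalues_mem_spectrum_real i
  rw [← spectrum.singleton_sub_eq, (adjMat_herm G).spectrum_real_eq_range_eigenvalues] at h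
  obtain ⟨a, ha, b, ⟨j, rfl⟩, hab⟩ := h
  rw [Set.mem_singleton_iff] at ha
  subst ha
  have : (adjMat_herm G).eigenvalues j ≤ specRad G :=
    le_ciSup (Set.finite_range _).bddAbove j
  simp only [Pi.zero_apply]
  rw [← hab]
  simpa using this

lemma quad_le_specRad {V : Type} [Fintype V] [DecidableEq V] (G : SimpleGraph V) (z : V → ℝ) :
    z ⬝ᵥ (adjMat G).mulVec z ≤ specRad G * (z ⬝ᵥ z) := by
  have h := (psd_of_specRad G).dotProduct_mulVec_nonneg z
  rw [Matrix.sub_mulVec, dotProduct_sub, Algebra.algebraMap_eq_smul_one, Matrix.smul_mulVec,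
    Matrix.one_mulVec, dotProduct_smul] at h
  simpa using h

lemma adjMat_nonneg {V : Type} [Fintype V] (G : SimpleGraph V) (u v : V) : 0 ≤ adjMat G u v := by
  classical
  simp only [adjMat, SimpleGraph.adjMatrix_apply]
  split_ifs <;> norm_num

lemma adjMat_one {V : Type} [Fintype V] {G : SimpleGraph V} {u v : V} (h : G.Adj u v) :
    adjMat G u v = 1 := by
  simp [adjMat, SimpleGraph.adjMatrix_apply, h]

lemma adjMat_zero {V : Type} [Fintype V] {G : SimpleGraph V} {u v : V} (h : ¬ G.Adj u v) :
    adjMat G u v = 0 := by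
  simp [adjMat, SimpleGraph.adjMatrix_apply, h]

lemma adjMat_le_one {V : Type} [Fintype V] (G : SimpleGraph V) (u v : V) : adjMat G u v ≤ 1 := by
  by_cases h : G.Adj u v
  · rw [adjMat_one h]
  · rw [adjMat_zero h]; norm_num

lemma adjMat_symm {V : Type} [Fintype V] (G : SimpleGraph V) (u v : V) :
    adjMat G u v = adjMat G v u := by
  by_cases h : G.Adj u v
  · rw [adjMat_one h, adjMat_one h.symm]
  · rw [adjMat_zero h, adjMat_zero (fun h' => h h'.symm)]

lemma exists_perron {V : Type} [Fintype V] [DecidableEq V] [Nonempty V] (G : SimpleGraph V) :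
    ∃ x : V → ℝ, x ≠ 0 ∧ (∀ v, 0 ≤ x v) ∧ (adjMat G).mulVec x = specRad G • x := by
  obtain ⟨i, hi⟩ := exists_eq_ciSup_of_finite (f := (adjMat_herm G).eigenvalues)
  change _ = specRad G at hi
  have hy := (adjMat_herm G).mulVec_eigenvectorBasis i
  have hy0 : (adjMat_herm G).eigenvectorBasis i ≠ 0 :=
    (adjMat_herm G).eigenvectorBasis.orthonormal.ne_zero i
  rw [hi] at hy
  set y : V → ℝ := ⇑((adjMat_herm G).eigenvectorBasis i) with hydef
  have hyne : y ≠ 0 := by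
    intro h
    apply hy0
    ext v
    exact congrFun h v
  have hq : y ⬝ᵥ (adjMat G).mulVec y = specRad G * (y ⬝ᵥ y) := by
    rw [hy, dotProduct_smul, smul_eq_mul]
  refine ⟨fun v => |y v|, ?_, fun v => abs_nonneg _, ?_⟩
  · intro h
    apply hyne
    ext v
    simpa using congrFun h v
  · have h1 : y ⬝ᵥ (adjMat G).mulVec y ≤
        (fun v => |y v|) ⬝ᵥ (adjMat G).mulVec (fun v => |y v|) := by
      simp only [dotProduct, Matrix.mulVec, Finset.mul_sum]
      refine Finset.sum_le_sum fun u _ => Finset.sum_le_sum fun v _ => ?_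
      calc y u * (adjMat G u v * y v) ≤ |y u * (adjMat G u v * y v)| := le_abs_self _
        _ = _ := by rw [abs_mul, abs_mul, abs_of_nonneg (adjMat_nonneg G u v)]
    have h2 : (fun v => |y v|) ⬝ᵥ (fun v => |y v|) = y ⬝ᵥ y := by
      simp [dotProduct]
    have h3 := (psd_of_specRad G).dotProduct_mulVec_zero_iff (fun v => |y v|)
    have h4 := quad_le_specRad G (fun v => |y v|)
    have h5 : (algebraMap ℝ (Matrix V V ℝ) (specRad G) - adjMat G).mulVec (fun v => |y v|) =
        specRad G • (fun v => |y v|) - (adjMat G).mulVec (fun v => |y v|) := by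
      rw [Matrix.sub_mulVec, Algebra.algebraMap_eq_smul_one, Matrix.smul_mulVec, Matrix.one_mulVec]
    rw [h5] at h3
    have h6 := h3.1 (by
      rw [star_trivial, dotProduct_sub, dotProduct_smul, smul_eq_mul]
      rw [h2] at h4 ⊢
      linarith)
    exact (sub_eq_zero.1 h6).symm

lemma edgeDegSum_eq {V : Type} [Fintype V] (G H : SimpleGraph V) :
    edgeDegSum G H = ∑ v, deg G v * deg H v := by
  classical
  unfold edgeDegSum
  rw [finsum_mem_eq_finite_toFinset_sum _ (Set.toFinite G.edgeSet)]
  have hEF : (Set.toFinite G.edgeSet).toFinset = G.edgeFinset := by ext; simp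
  rw [hEF]
  have h1 : ∀ e ∈ G.edgeFinset, Sym2.lift ⟨fun u v => deg H u + deg H v, fun u v => by dsimp; ring⟩ e
      = ∑ v, if v ∈ e then deg H v else 0 := by
    intro e he
    induction e with
    | _ a b =>
      have hab : a ≠ b := by
        rw [SimpleGraph.mem_edgeFinset, SimpleGraph.mem_edgeSet] at he
        exact he.ne
      have : ∀ v, (if v ∈ s(a, b) then deg H v else 0) =
          (if v = a then deg H v else 0) + (if v = b then deg H v else 0) := by
        intro v
        by_cases h1 : v = a
        · subst h1; simp [hab]
        · simp [h1]
      simp only [this, Finset.sum_add_distrib]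
      simp
  rw [Finset.sum_congr rfl h1, Finset.sum_comm]
  refine Finset.sum_congr rfl fun v _ => ?_
  rw [← Finset.sum_filter, Finset.sum_const, smul_eq_mul]
  congr 1
  have : G.edgeFinset.filter (v ∈ ·) = G.incidenceFinset v := by
    rw [SimpleGraph.incidenceFinset_eq_filter]
  rw [this, SimpleGraph.card_incidenceFinset_eq_degree, deg, Set.ncard_eq_toFinset_card']
  rfl

lemma deg_eq_sum {V : Type} [Fintype V] (G : SimpleGraph V) (v : V) :
    (deg G v : ℝ) = ∑ w, adjMat G v w := by
  classical
  simp only [adjMat, SimpleGraph.adjMatrix_apply, Finset.sum_boole, deg]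
  rw [Set.ncard_eq_toFinset_card']
  congr 2
  ext w
  simp

lemma sum_deg_eq {V : Type} [Fintype V] (G : SimpleGraph V) :
    ∑ v, deg G v = 2 * ecard G := by
  classical
  have := G.sum_degrees_eq_twice_card_edges
  rw [ecard, Set.ncard_eq_toFinset_card']
  have h2 : G.edgeSet.toFinset = G.edgeFinset := by ext; simp
  rw [h2, ← this]
  refine Finset.sum_congr rfl fun v _ => ?_
  rw [deg, Set.ncard_eq_toFinset_card']
  rfl

lemma core_est {W : Type} [Fintype W] (N : ℕ) (hN : Fintype.card W ≤ N) (a a' : W → W → ℝ)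
    (ha0 : ∀ u v, 0 ≤ a u v) (ha1 : ∀ u v, a u v ≤ 1)
    (ha0' : ∀ u v, 0 ≤ a' u v) (ha1' : ∀ u v, a' u v ≤ 1)
    (hs : ∀ u v, a u v = a v u) (hs' : ∀ u v, a' u v = a' v u)
    (ρ : ℝ) (hρ : 9 * (N:ℝ)^4 + 2 * N + 1 < ρ) (x : W → ℝ) (hx : ∀ w, 0 ≤ x w)
    (hx1 : ∀ w, ρ * x w = ρ + ∑ v, a w v * x v)
    (he : ∑ w, ∑ v, a' w v = ∑ w, ∑ v, a w v)
    (δ : W → ℝ) (hδ : ∀ w, ρ * δ w = ∑ v, a' w v - ∑ v, a w v)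
    (hR : ∑ w, ∑ v, δ w * a w v * δ v +
      ∑ w, ∑ v, (x w + δ w) * (a' w v - a w v) * (x v + δ v) ≤ ρ * ∑ w, δ w ^ 2) :
    ∑ w, (∑ v, a' w v) ^ 2 < ∑ w, (∑ v, a w v) ^ 2 + 1 := by
  have hN0 : (0:ℝ) ≤ N := Nat.cast_nonneg N
  have hN4 : (0:ℝ) ≤ (N:ℝ)^4 := by positivity
  have hρ0 : 0 < ρ := by linarith
  have hcard : ((Finset.univ : Finset W).card : ℝ) ≤ N := by exact_mod_cast hN
  -- generic sum bound
  have sb : ∀ (g : W → ℝ) (c : ℝ), 0 ≤ c → (∀ w, g w ≤ c) → ∑ w, g w ≤ N * c := by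
    intro g c hc hg
    calc ∑ w, g w ≤ ∑ w : W, c := Finset.sum_le_sum fun w _ => hg w
      _ = (Finset.univ : Finset W).card * c := by rw [Finset.sum_const, nsmul_eq_mul]
      _ ≤ N * c := by gcongr
  have hx2 : ∀ w, x w ≤ 2 := by
    intro w
    obtain ⟨m, -, hm⟩ := Finset.exists_max_image Finset.univ x ⟨w, Finset.mem_univ w⟩
    have h1 : ∑ v, a m v * x v ≤ N * x m := by
      apply sb _ _ (hx m)
      intro v
      calc a m v * x v ≤ 1 * x m := mul_le_mul (ha1 _ _) (hm v (Finset.mem_univ _)) (hx v) zero_le_one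
        _ = x m := one_mul _
    have h2 := hx1 m
    have h3 := hm w (Finset.mem_univ _)
    have h4 : x m ≤ 2 := by
      by_contra h
      push Not at h
      nlinarith
    linarith
  set d : W → ℝ := fun w => ∑ v, a w v with hd
  set d' : W → ℝ := fun w => ∑ v, a' w v with hd'
  have hd0 : ∀ w, 0 ≤ d w := fun w => Finset.sum_nonneg fun v _ => ha0 _ _
  have hd0' : ∀ w, 0 ≤ d' w := fun w => Finset.sum_nonneg fun v _ => ha0' _ _
  have hdN : ∀ w, d w ≤ N := fun w => by simpa using sb (a w) 1 zero_le_one (ha1 w)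
  have hdN' : ∀ w, d' w ≤ N := fun w => by simpa using sb (a' w) 1 zero_le_one (ha1' w)
  have hy0 : ∀ w, 0 ≤ ρ * (x w - 1) := by
    intro w
    have : 0 ≤ ∑ v, a w v * x v := Finset.sum_nonneg fun v _ => mul_nonneg (ha0 _ _) (hx _)
    linarith [hx1 w]
  have hy1 : ∀ w, ρ * (x w - 1) ≤ 2 * N := by
    intro w
    have : ∑ v, a w v * x v ≤ N * 2 := by
      apply sb _ _ (by norm_num)
      intro v
      nlinarith [ha0 w v, ha1 w v, hx v, hx2 v]
    linarith [hx1 w]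
  -- epsilon
  set ε : W → ℝ := fun w => ρ * (ρ * (x w - 1) - d w) with hε
  have hε1 : ∀ w, ε w = ∑ v, a w v * (ρ * (x v - 1)) := by
    intro w
    have : ρ * (x w - 1) - d w = ∑ v, a w v * (x v - 1) := by
      simp only [mul_sub, mul_one, Finset.sum_sub_distrib, hd]
      linarith [hx1 w]
    simp only [hε, this, Finset.mul_sum]
    exact Finset.sum_congr rfl fun v _ => by ring
  have hε0 : ∀ w, 0 ≤ ε w := fun w => by
    rw [hε1]; exact Finset.sum_nonneg fun v _ => mul_nonneg (ha0 _ _) (hy0 _)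
  have hεN : ∀ w, ε w ≤ 2 * (N:ℝ)^2 := fun w => by
    rw [hε1]
    have : ∑ v, a w v * (ρ * (x v - 1)) ≤ N * (2 * N) := by
      apply sb _ _ (by positivity)
      intro v
      nlinarith [ha0 w v, ha1 w v, hy0 v, hy1 v]
    linarith
  -- q = ρ (z - 1)
  set q : W → ℝ := fun w => ρ * (x w + δ w - 1) with hq
  have hq1 : ∀ w, ρ * q w = ρ * d' w + ε w := by
    intro w
    have := hδ w
    simp only [hq, hε, hd', hd] at *
    linear_combination ρ * this
  have hq0 : ∀ w, 0 ≤ q w := by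
    intro w
    have h1 := hq1 w
    have h2 := mul_nonneg hρ0.le (hd0' w)
    have h3 := hε0 w
    by_contra h
    push Not at h
    nlinarith
  have hqN : ∀ w, q w ≤ 2 * N := by
    intro w
    have h1 := hq1 w
    have h3 := hεN w
    have h4 := hdN' w
    by_contra h
    push Not at h
    nlinarith
  have hz : ∀ w, ρ * (x w + δ w) = ρ + q w := fun w => by simp only [hq]; ring
  -- error terms
  set f : W → ℝ := fun w => d' w - d w with hf
  have hfa : ∀ w, |f w| ≤ N := fun w => by
    rw [abs_le]; constructor <;> simp only [hf] <;> linarith [hd0 w, hd0' w, hdN w, hdN' w]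
  have E1 : -(∑ w, f w * ε w) ≤ 2 * (N:ℝ)^4 := by
    rw [← Finset.sum_neg_distrib]
    have : ∑ w, -(f w * ε w) ≤ N * (N * (2 * (N:ℝ)^2)) := by
      apply sb _ _ (by positivity)
      intro w
      calc -(f w * ε w) ≤ |f w * ε w| := neg_le_abs _
        _ = |f w| * ε w := by rw [abs_mul, abs_of_nonneg (hε0 w)]
        _ ≤ N * (2 * (N:ℝ)^2) := mul_le_mul (hfa w) (hεN w) (hε0 w) hN0
    linarith
  have E2 : -(∑ w, ∑ v, q w * (a' w v - a w v) * q v) ≤ 4 * (N:ℝ)^4 := by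
    rw [← Finset.sum_neg_distrib]
    have : ∑ w, -(∑ v, q w * (a' w v - a w v) * q v) ≤ N * (N * (2 * N * 1 * (2 * N))) := by
      apply sb _ _ (by positivity)
      intro w
      rw [← Finset.sum_neg_distrib]
      apply sb _ _ (by positivity)
      intro v
      have hab : |a' w v - a w v| ≤ 1 := by
        rw [abs_le]; constructor <;> linarith [ha0 w v, ha1 w v, ha0' w v, ha1' w v]
      calc -(q w * (a' w v - a w v) * q v) ≤ |q w * (a' w v - a w v) * q v| := neg_le_abs _
        _ = q w * |a' w v - a w v| * q v := by
          rw [abs_mul, abs_mul, abs_of_nonneg (hq0 w), abs_of_nonneg (hq0 v)]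
        _ ≤ 2 * N * 1 * (2 * N) := by
          have := hq0 w
          have := hq0 v
          have := hqN w
          have := hqN v
          gcongr
    linarith
  have E3 : -(∑ w, ∑ v, f w * a w v * f v) ≤ (N:ℝ)^4 := by
    rw [← Finset.sum_neg_distrib]
    have : ∑ w, -(∑ v, f w * a w v * f v) ≤ N * (N * (N * 1 * N)) := by
      apply sb _ _ (by positivity)
      intro w
      rw [← Finset.sum_neg_distrib]
      apply sb _ _ (by positivity)
      intro v
      calc -(f w * a w v * f v) ≤ |f w * a w v * f v| := neg_le_abs _
        _ = |f w| * a w v * |f v| := by rw [abs_mul, abs_mul, abs_of_nonneg (ha0 w v)]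
        _ ≤ N * 1 * N := by
          have := hfa w
          have := hfa v
          have := ha0 w v
          have := ha1 w v
          gcongr
    linarith
  -- identities, multiplied by ρ^2
  have I1 : ρ^2 * ∑ w, ∑ v, δ w * a w v * δ v = ∑ w, ∑ v, f w * a w v * f v := by
    simp only [Finset.mul_sum]
    refine Finset.sum_congr rfl fun w _ => Finset.sum_congr rfl fun v _ => ?_
    have h1 : ρ * δ w = f w := hδ w
    have h2 : ρ * δ v = f v := hδ v
    rw [← h1, ← h2]; ring
  have I2 : ρ^2 * (ρ * ∑ w, δ w ^ 2) = ρ * ∑ w, f w ^ 2 := by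
    simp only [Finset.mul_sum]
    refine Finset.sum_congr rfl fun w _ => ?_
    have h1 : ρ * δ w = f w := hδ w
    rw [← h1]; ring
  have hfsum : ∀ w, ∑ v, (a' w v - a w v) = f w := fun w => by
    simp only [Finset.sum_sub_distrib, hf, hd, hd']
  have hf0 : ∑ w, f w = 0 := by
    simp only [hf, Finset.sum_sub_distrib]; simp only [hd, hd']; linarith
  have I3 : ρ^2 * ∑ w, ∑ v, (x w + δ w) * (a' w v - a w v) * (x v + δ v) =
      2 * ρ * ∑ w, f w * q w + ∑ w, ∑ v, q w * (a' w v - a w v) * q v := by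
    have h1 : ρ^2 * ∑ w, ∑ v, (x w + δ w) * (a' w v - a w v) * (x v + δ v) =
        ∑ w, ∑ v, (ρ^2 * (a' w v - a w v) + ρ * ((a' w v - a w v) * q v) +
          ρ * ((a' w v - a w v) * q w) + q w * (a' w v - a w v) * q v) := by
      simp only [Finset.mul_sum]
      refine Finset.sum_congr rfl fun w _ => Finset.sum_congr rfl fun v _ => ?_
      have : ρ^2 * ((x w + δ w) * (a' w v - a w v) * (x v + δ v)) =
        (ρ * (x w + δ w)) * (a' w v - a w v) * (ρ * (x v + δ v)) := by ring
      rw [this, hz, hz]; ring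
    rw [h1]
    simp only [Finset.sum_add_distrib, ← Finset.mul_sum, ← Finset.sum_mul, hfsum, hf0]
    have h2 : ∑ w, ∑ v, (a' w v - a w v) * q v = ∑ w, f w * q w := by
      rw [Finset.sum_comm]
      refine Finset.sum_congr rfl fun w _ => ?_
      rw [← Finset.sum_mul, ← hfsum w]
      congr 1
      exact Finset.sum_congr rfl fun v _ => by rw [hs, hs']
    rw [h2]; ring
  have I4 : ρ * ∑ w, f w * q w = ρ * ∑ w, f w * d' w + ∑ w, f w * ε w := by
    simp only [Finset.mul_sum, ← Finset.sum_add_distrib]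
    refine Finset.sum_congr rfl fun w _ => ?_
    linear_combination f w * hq1 w
  have I5 : 2 * ∑ w, f w * d' w - ∑ w, f w ^ 2 = ∑ w, d' w ^ 2 - ∑ w, d w ^ 2 := by
    simp only [Finset.mul_sum, ← Finset.sum_sub_distrib]
    refine Finset.sum_congr rfl fun w _ => ?_
    simp only [hf]; ring
  have hR2 := mul_le_mul_of_nonneg_left hR (sq_nonneg ρ)
  rw [mul_add, I1, I2, I3] at hR2
  have h7 : ρ * (∑ w, d' w ^ 2 - ∑ w, d w ^ 2) ≤ 9 * (N:ℝ)^4 := by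
    rw [← I5]
    nlinarith
  by_contra hcon
  push Not at hcon
  have : 1 ≤ ∑ w, d' w ^ 2 - ∑ w, d w ^ 2 := by simp only [hd, hd']; linarith
  nlinarith

/-- Replace the part of `G` living on the range of `ι` by another graph. -/
def repl {V W : Type} (G : SimpleGraph V) (ι : W → V) (H' : SimpleGraph W) : SimpleGraph V where
  Adj u v := (u ≠ v ∧ ∃ a b, ι a = u ∧ ι b = v ∧ H'.Adj a b) ∨
    (G.Adj u v ∧ ¬ (u ∈ Set.range ι ∧ v ∈ Set.range ι))
  symm := ⟨by
    rintro u v (⟨hne, a, b, ha, hb, h⟩ | ⟨h, h'⟩)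
    · exact Or.inl ⟨hne.symm, b, a, hb, ha, h.symm⟩
    · exact Or.inr ⟨h.symm, fun h2 => h' ⟨h2.2, h2.1⟩⟩⟩
  loopless := ⟨by
    rintro u (⟨hne, -⟩ | ⟨h, h'⟩)
    · exact hne rfl
    · exact h.ne rfl⟩

lemma repl_adj_range {V W : Type} (G : SimpleGraph V) (ι : W → V) (hι : Function.Injective ι)
    (H' : SimpleGraph W) (a b : W) : (repl G ι H').Adj (ι a) (ι b) ↔ H'.Adj a b := by
  constructor
  · rintro (⟨-, a', b', ha, hb, h⟩ | ⟨h, h'⟩)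
    · rw [← hι ha, ← hι hb]; exact h
    · exact absurd ⟨⟨a, rfl⟩, ⟨b, rfl⟩⟩ h'
  · intro h
    exact Or.inl ⟨fun h2 => h.ne (hι h2), a, b, rfl, rfl, h⟩

lemma repl_adj_off {V W : Type} (G : SimpleGraph V) (ι : W → V)
    (H' : SimpleGraph W) (u v : V) (h : ¬ (u ∈ Set.range ι ∧ v ∈ Set.range ι)) :
    (repl G ι H').Adj u v ↔ G.Adj u v := by
  constructor
  · rintro (⟨-, a', b', ha, hb, -⟩ | ⟨h, -⟩)
    · exact absurd ⟨⟨a', ha⟩, ⟨b', hb⟩⟩ h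
    · exact h
  · intro h'
    exact Or.inr ⟨h', h⟩

lemma adjMat_congr {V W : Type} [Fintype V] [Fintype W] {G : SimpleGraph V} {H : SimpleGraph W}
    {u v : V} {a b : W} (h : G.Adj u v ↔ H.Adj a b) : adjMat G u v = adjMat H a b := by
  by_cases h1 : H.Adj a b
  · rw [adjMat_one h1, adjMat_one (h.2 h1)]
  · rw [adjMat_zero h1, adjMat_zero (fun h2 => h1 (h.1 h2))]

lemma sum_range_split {V W : Type} [Fintype V] [Fintype W] [DecidableEq V] (ι : W → V)
    (hι : Function.Injective ι) (F : V → ℝ) (hF : ∀ v, v ∉ Set.range ι → F v = 0) :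
    ∑ v, F v = ∑ w, F (ι w) := by
  have h := Finset.sum_image (f := F) (s := Finset.univ) (g := ι) (fun a _ b _ h => hι h)
  rw [← h]
  symm
  apply Finset.sum_subset (Finset.subset_univ _)
  intro v _ hv
  apply hF
  rintro ⟨w, rfl⟩
  exact hv (Finset.mem_image_of_mem _ (Finset.mem_univ _))

lemma sum_range_split2 {V W : Type} [Fintype V] [Fintype W] [DecidableEq V] (ι : W → V)
    (hι : Function.Injective ι) (F : V → V → ℝ)
    (hF : ∀ u v, ¬ (u ∈ Set.range ι ∧ v ∈ Set.range ι) → F u v = 0) :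
    ∑ u, ∑ v, F u v = ∑ a, ∑ b, F (ι a) (ι b) := by
  rw [sum_range_split ι hι]
  · refine Finset.sum_congr rfl fun a _ => ?_
    rw [sum_range_split ι hι]
    intro v hv
    exact hF _ _ (fun h => hv h.2)
  · intro u hu
    exact Finset.sum_eq_zero fun v _ => hF _ _ (fun h => hu h.1)

lemma spectral_part {V W : Type} [Fintype V] [DecidableEq V] [Fintype W] (N : ℕ)
    (hN : Fintype.card W ≤ N) (hV : (9 * N^4 + 2 * N + 2)^2 + 1 ≤ Fintype.card V)
    (G : SimpleGraph V) (K : Finset V) (hK : K.Nonempty) (hcl : G.IsClique (↑K : Set V))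
    (hdom : ∀ v, v ∉ K → ∀ u ∈ K, G.Adj u v)
    (ι : W → V) (hι : Function.Injective ι) (hιK : ∀ w, ι w ∉ K)
    (hclosed : ∀ w v, v ∉ K → G.Adj (ι w) v → v ∈ Set.range ι)
    (H' : SimpleGraph W) (he : ecard H' = ecard (G.comap ι))
    (hmax : specRad (repl G ι H') ≤ specRad G) :
    ∑ w, deg H' w ^ 2 ≤ ∑ w, deg (G.comap ι) w ^ 2 := by
  have : Nonempty V := ⟨hK.choose⟩
  obtain ⟨x₀, hx₀ne, hx₀, hx₀e⟩ := exists_perron G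
  obtain ⟨u₀, hu₀⟩ := hK
  set ρ := specRad G with hρdef
  have hadj : ∀ u ∈ K, ∀ v, v ≠ u → G.Adj u v := by
    intro u hu v hvu
    by_cases hv : v ∈ K
    · exact hcl hu hv hvu.symm
    · exact hdom v hv u hu
  have heig₀ : ∀ u, ∑ v, adjMat G u v * x₀ v = ρ * x₀ u := fun u => congrFun hx₀e u
  have hrow : ρ * x₀ u₀ = ∑ v ∈ Finset.univ.erase u₀, x₀ v := by
    rw [← heig₀ u₀, ← Finset.add_sum_erase _ _ (Finset.mem_univ u₀),
      adjMat_zero (G.loopless.irrefl u₀), zero_mul, zero_add]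
    refine Finset.sum_congr rfl fun v hv => ?_
    rw [adjMat_one (hadj u₀ hu₀ v (Finset.ne_of_mem_erase hv)), one_mul]
  have hpos : 0 < x₀ u₀ := by
    rcases (hx₀ u₀).lt_or_eq with h | h
    · exact h
    · exfalso
      apply hx₀ne
      rw [← h, mul_zero] at hrow
      have := (Finset.sum_eq_zero_iff_of_nonneg (fun v _ => hx₀ v)).1 hrow.symm
      ext v
      by_cases hv : v = u₀
      · rw [hv, ← h]; rfl
      · exact this v (Finset.mem_erase.2 ⟨hv, Finset.mem_univ _⟩)
  have hρ0 : 0 ≤ ρ := by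
    have : 0 ≤ ρ * x₀ u₀ := by rw [hrow]; exact Finset.sum_nonneg fun v _ => hx₀ v
    exact nonneg_of_mul_nonneg_left this hpos
  have hρ2 : ((Fintype.card V : ℝ) - 1) ≤ ρ ^ 2 := by
    have h1 : ∀ v ∈ Finset.univ.erase u₀, x₀ u₀ ≤ ρ * x₀ v := by
      intro v hv
      rw [← heig₀ v]
      have h2 := Finset.single_le_sum (f := fun w => adjMat G v w * x₀ w)
        (fun w _ => mul_nonneg (adjMat_nonneg G v w) (hx₀ w)) (Finset.mem_univ u₀)
      simp only [adjMat_one (hadj u₀ hu₀ v (Finset.ne_of_mem_erase hv)).symm, one_mul] at h2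
      exact h2
    have h2 := Finset.sum_le_sum h1
    rw [← Finset.mul_sum, ← hrow, Finset.sum_const, nsmul_eq_mul,
      Finset.card_erase_of_mem (Finset.mem_univ _), Finset.card_univ,
      Nat.cast_sub (Nat.one_le_of_lt (lt_of_lt_of_le (Nat.lt_succ_of_le (Nat.zero_le _)) hV))] at h2
    push_cast at h2
    nlinarith
  have hρbig : 9 * (N:ℝ)^4 + 2 * N + 1 < ρ := by
    have h1 : ((9 * (N:ℝ)^4 + 2 * N + 2)^2 + 1) ≤ Fintype.card V := by exact_mod_cast hV
    have h2 : (9 * (N:ℝ)^4 + 2 * N + 2)^2 ≤ ρ ^ 2 := by linarith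
    have h3 := abs_le_of_sq_le_sq h2 hρ0
    linarith [le_abs_self (9 * (N:ℝ)^4 + 2 * N + 2)]
  have hρp : 0 < ρ := lt_of_le_of_lt (by positivity) hρbig
  have hσ : 0 < ∑ u ∈ K, x₀ u := Finset.sum_pos' (fun u _ => hx₀ u) ⟨u₀, hu₀, hpos⟩
  set c : ℝ := ρ / ∑ u ∈ K, x₀ u with hc
  have hc0 : 0 ≤ c := by positivity
  set x : V → ℝ := fun v => c * x₀ v with hxdef
  have hx : ∀ v, 0 ≤ x v := fun v => mul_nonneg hc0 (hx₀ v)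
  have hxK : ∑ u ∈ K, x u = ρ := by
    simp only [hxdef]
    rw [← Finset.mul_sum, hc]; field_simp
  have heig : ∀ u, ∑ v, adjMat G u v * x v = ρ * x u := by
    intro u
    have : ∑ v, adjMat G u v * x v = c * ∑ v, adjMat G u v * x₀ v := by
      rw [Finset.mul_sum]
      exact Finset.sum_congr rfl fun v _ => by simp only [hxdef]; ring
    rw [this, heig₀]; simp only [hxdef]; ring
  have haH : ∀ a b, adjMat (G.comap ι) a b = adjMat G (ι a) (ι b) := fun a b =>
    adjMat_congr (by simp)
  have haH' : ∀ a b, adjMat H' a b = adjMat (repl G ι H') (ι a) (ι b) := fun a b =>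
    adjMat_congr (repl_adj_range G ι hι H' a b).symm
  have hx1 : ∀ w, ρ * x (ι w) = ρ + ∑ v, adjMat (G.comap ι) w v * x (ι v) := by
    intro w
    rw [← heig (ι w), ← Finset.sum_add_sum_compl K]
    congr 1
    · rw [← hxK]
      refine Finset.sum_congr rfl fun u hu => ?_
      rw [adjMat_one (hdom _ (hιK w) u hu).symm, one_mul]
    · simp only [haH]
      have h5 := sum_range_split ι hι (fun v => if v ∈ K then 0 else adjMat G (ι w) v * x v) ?_
      · simp only [hιK, if_false] at h5
        rw [← h5, Finset.sum_ite, Finset.sum_const_zero, zero_add]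
        refine Finset.sum_congr ?_ fun _ _ => rfl
        ext v; simp
      · intro v hv
        split_ifs with h
        · rfl
        · rw [adjMat_zero (fun h2 => hv (hclosed w v h h2)), zero_mul]
  set δ : W → ℝ := fun w => (∑ v, adjMat H' w v - ∑ v, adjMat (G.comap ι) w v) / ρ with hδ
  set e : V → ℝ := fun v => ∑ w, if ι w = v then δ w else 0 with hedef
  have he1 : ∀ w, e (ι w) = δ w := by
    intro w
    simp only [hedef]
    rw [Finset.sum_eq_single w]
    · simp
    · intro b _ hb; exact if_neg fun h => hb (hι h)
    · simp
  have he2 : ∀ v, v ∉ Set.range ι → e v = 0 := by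
    intro v hv
    exact Finset.sum_eq_zero fun w _ => if_neg fun h => hv ⟨w, h⟩
  have hRay := quad_le_specRad (repl G ι H') (x + e)
  have hzz : 0 ≤ (x + e) ⬝ᵥ (x + e) := by
    simp only [dotProduct]; exact Finset.sum_nonneg fun v _ => mul_self_nonneg _
  have hRay2 := hRay.trans (mul_le_mul_of_nonneg_right hmax hzz)
  have key : ∑ w, ∑ v, δ w * adjMat (G.comap ι) w v * δ v +
      ∑ w, ∑ v, (x (ι w) + δ w) * (adjMat H' w v - adjMat (G.comap ι) w v) * (x (ι v) + δ v)
        ≤ ρ * ∑ w, δ w ^ 2 := by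
    have J1 : ∑ w, ∑ v, δ w * adjMat (G.comap ι) w v * δ v =
        ∑ u, ∑ v, e u * adjMat G u v * e v := by
      rw [sum_range_split2 ι hι]
      · simp only [he1, haH]
      · intro u v h
        by_cases hu : u ∈ Set.range ι
        · rw [he2 v (fun hv => h ⟨hu, hv⟩), mul_zero]
        · rw [he2 u hu, zero_mul, zero_mul]
    have J2 : ∑ w, ∑ v, (x (ι w) + δ w) * (adjMat H' w v - adjMat (G.comap ι) w v) *
        (x (ι v) + δ v) =
        ∑ u, ∑ v, (x u + e u) * (adjMat (repl G ι H') u v - adjMat G u v) * (x v + e v) := by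
      rw [sum_range_split2 ι hι]
      · simp only [he1, haH, haH']
      · intro u v h
        rw [adjMat_congr (repl_adj_off G ι H' u v h), sub_self, mul_zero, zero_mul]
    have J3 : ∑ w, δ w ^ 2 = ∑ v, e v ^ 2 := by
      rw [sum_range_split ι hι]
      · simp only [he1]
      · intro v hv; rw [he2 v hv]; norm_num
    have J4 : (x + e) ⬝ᵥ (adjMat (repl G ι H')).mulVec (x + e) =
        ∑ u, ∑ v, (x u + e u) * (adjMat (repl G ι H') u v - adjMat G u v) * (x v + e v) +
        ∑ u, ∑ v, (x u + e u) * adjMat G u v * (x v + e v) := by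
      simp only [dotProduct, Matrix.mulVec, Finset.mul_sum, Pi.add_apply, ← Finset.sum_add_distrib]
      exact Finset.sum_congr rfl fun u _ => Finset.sum_congr rfl fun v _ => by ring
    have J5 : ∑ u, ∑ v, (x u + e u) * adjMat G u v * (x v + e v) =
        ∑ u, x u * (ρ * x u) + 2 * ∑ u, e u * (ρ * x u) +
          ∑ u, ∑ v, e u * adjMat G u v * e v := by
      have k1 : ∑ u, ∑ v, (x u + e u) * adjMat G u v * (x v + e v) =
          ∑ u, ∑ v, (x u * (adjMat G u v * x v) + e u * (adjMat G u v * x v) +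
            e v * (adjMat G v u * x u) + e u * adjMat G u v * e v) := by
        refine Finset.sum_congr rfl fun u _ => Finset.sum_congr rfl fun v _ => ?_
        rw [adjMat_symm G v u]; ring
      rw [k1]
      simp only [Finset.sum_add_distrib]
      rw [Finset.sum_comm (f := fun u v => e v * (adjMat G v u * x u))]
      simp only [← Finset.mul_sum, heig]
      ring
    have J6 : ρ * ((x + e) ⬝ᵥ (x + e)) =
        ∑ u, x u * (ρ * x u) + 2 * ∑ u, e u * (ρ * x u) + ρ * ∑ u, e u ^ 2 := by
      simp only [dotProduct, Finset.mul_sum, Pi.add_apply, ← Finset.sum_add_distrib]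
      exact Finset.sum_congr rfl fun u _ => by ring
    rw [J1, J2, J3]
    rw [J4, J5, J6] at hRay2
    linarith
  have hsum : ∑ w, ∑ v, adjMat H' w v = ∑ w, ∑ v, adjMat (G.comap ι) w v := by
    simp only [← deg_eq_sum, ← Nat.cast_sum]
    rw [sum_deg_eq, sum_deg_eq, he]
  have fin := core_est N hN (adjMat (G.comap ι)) (adjMat H') (adjMat_nonneg _) (adjMat_le_one _)
    (adjMat_nonneg _) (adjMat_le_one _) (adjMat_symm _) (adjMat_symm _) ρ hρbig (fun w => x (ι w))
    (fun w => hx _) hx1 hsum δ (fun w => by simp only [hδ]; field_simp) key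
  simp only [← deg_eq_sum] at fin
  have fin2 : ∑ w, deg H' w ^ 2 < ∑ w, deg (G.comap ι) w ^ 2 + 1 := by exact_mod_cast fin
  omega
lemma one_side {V : Type} (G : SimpleGraph V) (A T : Set V) (hc : (G.induce A).Connected)
    (hT : ∀ u ∈ A, ∀ v ∈ A, G.Adj u v → (u ∈ T ↔ v ∈ T)) :
    ∀ u ∈ A, ∀ v ∈ A, (u ∈ T ↔ v ∈ T) := by
  have key : ∀ p q : A, (G.induce A).Walk p q → ((p : V) ∈ T ↔ (q : V) ∈ T) := by
    intro p q w
    induction w with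
    | nil => exact Iff.rfl
    | @cons a b c h w ih => exact (hT a a.2 b b.2 h).trans ih
  intro u hu v hv
  obtain ⟨w⟩ := hc.preconnected ⟨u, hu⟩ ⟨v, hv⟩
  exact key _ _ w

lemma minor_part {V W : Type} [DecidableEq V] (s t : ℕ) (hst : s ≤ t)
    (G : SimpleGraph V) (K : Finset V) (hKc : K.card + 1 = s) (hcl : G.IsClique (↑K : Set V))
    (hdom : ∀ v, v ∉ K → ∀ u ∈ K, G.Adj u v)
    (hG : ¬ MinorOf (completeBipartiteGraph (Fin s) (Fin t)) G)
    (ι : W → V) (hι : Function.Injective ι)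
    (hclosed : ∀ w v, v ∉ K → G.Adj (ι w) v → v ∈ Set.range ι)
    (H' : SimpleGraph W) (hH' : HasSTProp s t H') :
    ¬ MinorOf (completeBipartiteGraph (Fin s) (Fin t)) (repl G ι H') := by
  classical
  rintro ⟨φ, hφc, hφd, hφa⟩
  have hVne : Nonempty V := by
    obtain ⟨x⟩ := (hφc (Sum.inl ⟨0, by omega⟩)).nonempty
    exact ⟨x.1⟩
  have hadj : ∀ u ∈ K, ∀ v, v ≠ u → G.Adj u v := by
    intro u hu v hvu
    by_cases hv : v ∈ K
    · exact hcl hu hv hvu.symm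
    · exact hdom v hv u hu
  -- branch sets hitting `K`
  let hit : Fin s ⊕ Fin t → Prop := fun a => ∃ k ∈ K, k ∈ φ a
  have hcard : (Finset.univ.filter hit).card ≤ K.card := by
    choose! k hkK hkφ using fun (a : Fin s ⊕ Fin t) (h : hit a) => h
    apply Finset.card_le_card_of_injOn k
    · intro a ha
      exact hkK a (Finset.mem_filter.1 ha).2
    · intro a ha b hb hab
      by_contra hne
      have h1 := hkφ a (Finset.mem_filter.1 ha).2
      have h2 := hkφ b (Finset.mem_filter.1 hb).2
      rw [← hab] at h2
      exact Set.disjoint_left.1 (hφd hne) h1 h2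
  let P : Finset (Fin s) := Finset.univ.filter fun i => ¬ hit (Sum.inl i)
  let Q : Finset (Fin t) := Finset.univ.filter fun j => ¬ hit (Sum.inr j)
  have hPQ : t + 1 ≤ P.card + Q.card := by
    have h1 : P.card + Q.card = (Finset.univ.filter fun a => ¬ hit a).card := by
      rw [← Finset.card_disjSum]
      congr 1
      ext a
      rcases a with a | a <;> simp [P, Q]
    have h2 := Finset.card_filter_add_card_filter_not (s := Finset.univ) hit
    rw [Finset.card_univ, Fintype.card_sum, Fintype.card_fin, Fintype.card_fin] at h2
    omega
  have hPs : P.card ≤ s := by simpa using Finset.card_le_univ P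
  have hQt : Q.card ≤ t := by simpa using Finset.card_le_univ Q
  have hP1 : 1 ≤ P.card := by omega
  have hQ1 : 1 ≤ Q.card := by omega
  obtain ⟨p₀, hp₀⟩ := Finset.card_pos.1 hP1
  obtain ⟨q₀, hq₀⟩ := Finset.card_pos.1 hQ1
  set T : Set V := Set.range ι with hT
  -- no crossing edges off `K`
  have hcross : ∀ u v, u ∉ K → v ∉ K → (repl G ι H').Adj u v → (u ∈ T ↔ v ∈ T) := by
    intro u v hu hv h
    rcases h with ⟨-, a, b, ha, hb, -⟩ | ⟨h, -⟩
    · exact ⟨fun _ => ⟨b, hb⟩, fun _ => ⟨a, ha⟩⟩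
    · constructor
      · rintro ⟨w, rfl⟩; exact hclosed w v hv h
      · rintro ⟨w, rfl⟩; exact hclosed w u hu h.symm
  have hnot : ∀ a, ¬ hit a → ∀ u ∈ φ a, u ∉ K := fun a ha u hu hk => ha ⟨u, hk, hu⟩
  have hside : ∀ a, ¬ hit a → ∀ u ∈ φ a, ∀ v ∈ φ a, (u ∈ T ↔ v ∈ T) := fun a ha =>
    one_side _ _ _ (hφc a) fun u hu v hv h => hcross u v (hnot a ha u hu) (hnot a ha v hv) h
  have hside2 : ∀ a b, ¬ hit a → ¬ hit b → (completeBipartiteGraph (Fin s) (Fin t)).Adj a b →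
      ∀ u ∈ φ a, ∀ v ∈ φ b, (u ∈ T ↔ v ∈ T) := by
    intro a b ha hb hab u hu v hv
    obtain ⟨x, hx, y, hy, hxy⟩ := hφa a b hab
    exact ((hside a ha u hu x hx).trans
      (hcross x y (hnot a ha x hx) (hnot b hb y hy) hxy)).trans (hside b hb y hy v hv)
  have hPm : ∀ i, i ∈ P ↔ ¬ hit (Sum.inl i) := fun i => by simp [P]
  have hQm : ∀ i, i ∈ Q ↔ ¬ hit (Sum.inr i) := fun i => by simp [Q]
  obtain ⟨⟨u₀, hu₀⟩⟩ := (hφc (Sum.inl p₀)).nonempty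
  have hR : ∀ j, ¬ hit (Sum.inr j) → ∀ v ∈ φ (Sum.inr j), (u₀ ∈ T ↔ v ∈ T) := fun j hj v hv =>
    hside2 (Sum.inl p₀) (Sum.inr j) ((hPm _).1 hp₀) hj (by simp) u₀ hu₀ v hv
  obtain ⟨⟨v₀, hv₀⟩⟩ := (hφc (Sum.inr q₀)).nonempty
  have hall : ∀ a, ¬ hit a → ∀ v ∈ φ a, (u₀ ∈ T ↔ v ∈ T) := by
    intro a ha v hv
    rcases a with i | j
    · exact (hR q₀ ((hQm _).1 hq₀) v₀ hv₀).trans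
        (hside2 (Sum.inr q₀) (Sum.inl i) ((hQm _).1 hq₀) ha (by simp) v₀ hv₀ v hv)
    · exact hR j ha v hv
  by_cases hu₀T : u₀ ∈ T
  · -- everything inside `T`: a minor of the new graph
    have hin : ∀ a, ¬ hit a → ∀ v ∈ φ a, v ∈ T := fun a ha v hv => (hall a ha v hv).1 hu₀T
    let ψ : Fin s ⊕ Fin t → Set W := fun a => ι ⁻¹' (φ a)
    have hψc : ∀ a, ¬ hit a → (H'.induce (ψ a)).Connected := by
      intro a ha
      choose g hg using fun v : φ a => hin a ha v v.2
      let f : (repl G ι H').induce (φ a) →g H'.induce (ψ a) :=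
        { toFun := fun v => ⟨g v, by change ι (g v) ∈ φ a; rw [hg]; exact v.2⟩
          map_rel' := by
            intro u v h
            change H'.Adj (g u) (g v)
            rw [← repl_adj_range G ι hι, hg, hg]
            exact h }
      apply SimpleGraph.Connected.map f _ (hφc a)
      rintro ⟨w, hw⟩
      refine ⟨⟨ι w, hw⟩, Subtype.ext (hι ?_)⟩
      exact hg _
    have hψd : ∀ a b, a ≠ b → Disjoint (ψ a) (ψ b) := fun a b hab =>
      Disjoint.preimage ι (hφd hab)
    have hψa : ∀ a b, ¬ hit a → ¬ hit b → (completeBipartiteGraph (Fin s) (Fin t)).Adj a b →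
        ∃ x ∈ ψ a, ∃ y ∈ ψ b, H'.Adj x y := by
      intro a b ha hb hab
      obtain ⟨x, hx, y, hy, hxy⟩ := hφa a b hab
      obtain ⟨x, rfl⟩ := hin a ha x hx
      obtain ⟨y, rfl⟩ := hin b hb y hy
      exact ⟨x, hx, y, hy, (repl_adj_range G ι hι H' x y).1 hxy⟩
    -- restricted minors
    have hmin : ∀ (A B : Type) (f : A ⊕ B → Fin s ⊕ Fin t), Function.Injective f →
        (∀ a, ¬ hit (f a)) →
        (∀ a b, (completeBipartiteGraph (Fin s) (Fin t)).Adj (f (Sum.inl a)) (f (Sum.inr b))) →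
        MinorOf (completeBipartiteGraph A B) H' := by
      intro A B f hf hfh hfa
      refine ⟨fun a => ψ (f a), fun a => hψc _ (hfh a), fun a b hab => hψd _ _ (hf.ne hab), ?_⟩
      intro a b hab
      apply hψa _ _ (hfh a) (hfh b)
      rcases a with a | a <;> rcases b with b | b
      · simp at hab
      · exact hfa _ _
      · exact (hfa _ _).symm
      · simp at hab
    -- choose sizes
    obtain ⟨a, b, ha1, hb1, hab, haP, hbQ⟩ : ∃ a b, 1 ≤ a ∧ 1 ≤ b ∧ a + b = t + 1 ∧
        a ≤ P.card ∧ b ≤ Q.card :=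
      ⟨t + 1 - Q.card, Q.card, by omega, hQ1, by omega, by omega, le_rfl⟩
    obtain ⟨P', hP'P, hP'c⟩ := Finset.exists_subset_card_eq haP
    obtain ⟨Q', hQ'Q, hQ'c⟩ := Finset.exists_subset_card_eq hbQ
    let eP : Fin a → Fin s := fun i => P'.orderEmbOfFin hP'c i
    let eQ : Fin b → Fin t := fun i => Q'.orderEmbOfFin hQ'c i
    have heP : Function.Injective eP := (P'.orderEmbOfFin hP'c).injective
    have heQ : Function.Injective eQ := (Q'.orderEmbOfFin hQ'c).injective
    have hePm : ∀ i, ¬ hit (Sum.inl (eP i)) := fun i =>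
      (hPm _).1 (hP'P (Finset.orderEmbOfFin_mem _ _ _))
    have heQm : ∀ i, ¬ hit (Sum.inr (eQ i)) := fun i =>
      (hQm _).1 (hQ'Q (Finset.orderEmbOfFin_mem _ _ _))
    by_cases hle : a ≤ (t + 1) / 2
    · refine hH' a b ha1 hb1 hab (le_min (haP.trans hPs) hle)
        (hmin _ _ (Sum.elim (fun i => Sum.inl (eP i)) (fun j => Sum.inr (eQ j))) ?_ ?_ ?_)
      · rintro (i | i) (j | j) h <;> simp at h ⊢
        · exact heP h
        · exact heQ h
      · rintro (i | i)
        · exact hePm i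
        · exact heQm i
      · intro i j; simp
    · refine hH' b a hb1 ha1 (by omega) (le_min (by omega) (by omega))
        (hmin _ _ (Sum.elim (fun j => Sum.inr (eQ j)) (fun i => Sum.inl (eP i))) ?_ ?_ ?_)
      · rintro (i | i) (j | j) h <;> simp at h ⊢
        · exact heQ h
        · exact heP h
      · rintro (i | i)
        · exact heQm i
        · exact hePm i
      · intro i j; simp
  · -- everything outside `T`: a minor of `G`
    have hout : ∀ a, ¬ hit a → ∀ v ∈ φ a, v ∉ T := fun a ha v hv h => hu₀T ((hall a ha v hv).2 h)
    apply hG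
    choose! k hkK hkφ using fun (a : Fin s ⊕ Fin t) (h : hit a) => h
    let ψ : Fin s ⊕ Fin t → Set V := fun a => if hit a then {k a} else φ a
    have hψ1 : ∀ a, hit a → ψ a = {k a} := fun a h => if_pos h
    have hψ2 : ∀ a, ¬ hit a → ψ a = φ a := fun a h => if_neg h
    have hsub : ∀ a, ψ a ⊆ φ a := by
      intro a
      by_cases h : hit a
      · rw [hψ1 a h]; exact Set.singleton_subset_iff.2 (hkφ a h)
      · rw [hψ2 a h]
    have hd : Pairwise fun a b => Disjoint (ψ a) (ψ b) := fun a b hab =>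
      (hφd hab).mono (hsub a) (hsub b)
    have hc : ∀ a, (G.induce (ψ a)).Connected := by
      intro a
      by_cases h : hit a
      · rw [hψ1 a h]
        have : Subsingleton ({k a} : Set V) :=
          Set.subsingleton_singleton.coe_sort
        exact { preconnected := fun x y => by rw [Subsingleton.elim x y]
                nonempty := ⟨⟨k a, rfl⟩⟩ }
      · rw [hψ2 a h]
        refine (hφc a).mono ?_
        intro u v huv
        exact (repl_adj_off G ι H' u v (fun h2 => hout a h u u.2 h2.1)).1 huv
    have hne : ∀ a, ∃ x, x ∈ ψ a := fun a => by
      obtain ⟨x⟩ := (hc a).nonempty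
      exact ⟨x.1, x.2⟩
    refine ⟨ψ, hc, hd, ?_⟩
    intro a b hab
    by_cases ha : hit a
    · obtain ⟨y, hy⟩ := hne b
      have hka : k a ∈ ψ a := by rw [hψ1 a ha]; rfl
      refine ⟨k a, hka, y, hy, hadj _ (hkK a ha) _ ?_⟩
      rintro rfl
      exact Set.disjoint_left.1 (hd hab.ne) hka hy
    · by_cases hb : hit b
      · obtain ⟨x, hx⟩ := hne a
        have hkb : k b ∈ ψ b := by rw [hψ1 b hb]; rfl
        refine ⟨x, hx, k b, hkb, (hadj _ (hkK b hb) _ ?_).symm⟩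
        rintro rfl
        exact Set.disjoint_left.1 (hd hab.ne) hx hkb
      · rw [hψ2 a ha, hψ2 b hb]
        obtain ⟨x, hx, y, hy, hxy⟩ := hφa a b hab
        exact ⟨x, hx, y, hy, (repl_adj_off G ι H' x y (fun h2 => hout a ha x hx h2.1)).1 hxy⟩

/-- Lemma 2.5 (degree-sum conditions for local edge replacement). -/
theorem local_degree_sum (s t N : ℕ) (hs : 2 ≤ s) (hst : s ≤ t) :
    ∃ n₀ : ℕ, ∀ n : ℕ, n₀ ≤ n →
    ∀ (G : SimpleGraph (Fin n)) (K : Finset (Fin n)),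
      ¬ MinorOf (completeBipartiteGraph (Fin s) (Fin t)) G →
      (∀ G' : SimpleGraph (Fin n),
        ¬ MinorOf (completeBipartiteGraph (Fin s) (Fin t)) G' → specRad G' ≤ specRad G) →
      K.card = s - 1 → G.IsClique (↑K : Set (Fin n)) →
      (∀ v : Fin n, v ∉ K → ∀ u ∈ K, G.Adj u v) →
      ∀ S : Set {v : Fin n // v ∉ K},
        (∀ u v : {v : Fin n // v ∉ K},
          (G.comap (Subtype.val : {v : Fin n // v ∉ K} → Fin n)).Reachable u v →
            (u ∈ S ↔ v ∈ S)) →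
        S.ncard ≤ N →
        ∀ H' : SimpleGraph ↥S, HasSTProp s t H' →
          ecard H' = ecard ((G.comap (Subtype.val : {v : Fin n // v ∉ K} → Fin n)).induce S) →
          (edgeDegSum H' ((G.comap (Subtype.val : {v : Fin n // v ∉ K} → Fin n)).induce S) ≤
            edgeDegSum ((G.comap (Subtype.val : {v : Fin n // v ∉ K} → Fin n)).induce S)
              ((G.comap (Subtype.val : {v : Fin n // v ∉ K} → Fin n)).induce S) ∧
          (edgeDegSum H' ((G.comap (Subtype.val : {v : Fin n // v ∉ K} → Fin n)).induce S) =
            edgeDegSum ((G.comap (Subtype.val : {v : Fin n // v ∉ K} → Fin n)).induce S)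
              ((G.comap (Subtype.val : {v : Fin n // v ∉ K} → Fin n)).induce S) →
            edgeDegSum H' H' ≤
              edgeDegSum ((G.comap (Subtype.val : {v : Fin n // v ∉ K} → Fin n)).induce S)
                ((G.comap (Subtype.val : {v : Fin n // v ∉ K} → Fin n)).induce S))) := by
  refine ⟨(9 * N^4 + 2 * N + 2)^2 + 1, ?_⟩
  intro n hn G K hG hmax hKc hcl hdom S hS hSN H' hH' he
  classical
  have : Fintype ↥S := Fintype.ofFinite _
  let ι : ↥S → Fin n := fun w => w.1.1
  have hι : Function.Injective ι := fun a b h => Subtype.ext (Subtype.ext h)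
  have hιK : ∀ w, ι w ∉ K := fun w => w.1.2
  have hclosed : ∀ w v, v ∉ K → G.Adj (ι w) v → v ∈ Set.range ι := by
    intro w v hv h
    have h2 : (G.comap (Subtype.val : {v : Fin n // v ∉ K} → Fin n)).Adj w.1 ⟨v, hv⟩ := h
    exact ⟨⟨⟨v, hv⟩, (hS _ _ h2.reachable).1 w.2⟩, rfl⟩
  have hHeq : (G.comap (Subtype.val : {v : Fin n // v ∉ K} → Fin n)).induce S = G.comap ι := rfl
  rw [hHeq] at he ⊢
  have hK : K.Nonempty := Finset.card_pos.1 (by omega)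
  have h1 := minor_part s t hst G K (by omega) hcl hdom hG ι hι hclosed H' hH'
  have hcard : Fintype.card ↥S ≤ N := by
    rwa [← Nat.card_eq_fintype_card, Nat.card_coe_set_eq]
  have h2 := spectral_part N hcard (by simpa using hn) G K hK hcl hdom ι hι hιK hclosed H' he
    (hmax _ h1)
  simp only [edgeDegSum_eq]
  simp only [sq] at h2
  refine ⟨?_, fun _ => h2⟩
  have h3 : 2 * ∑ w, deg H' w * deg (G.comap ι) w ≤
      ∑ w, deg H' w * deg H' w + ∑ w, deg (G.comap ι) w * deg (G.comap ι) w := by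
    rw [Finset.mul_sum, ← Finset.sum_add_distrib]
    refine Finset.sum_le_sum fun w _ => ?_
    have := two_mul_le_add_sq (deg H' w) (deg (G.comap ι) w)
    nlinarith
  omega
end

section
/- Let 2 ≤ s ≤ t and N be fixed integers. There exists n₀ such that for all n ≥ n₀ the following holds: with G⋆ and K as in the extremal setup, let H be the disjoint union of some collection of connected components of G⋆ − K with |V(H)| ≤ N, and let H′ be a graph on the vertex set V(H) having the (s,t)-property with e(H′) = e(H). If the non-increasing degree sequence π(H) is majorized by π(H′), then π(H) = π(H′). -/
open SimpleGraph

/-- `a` is the non-increasing degree sequence of `G`. -/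
def IsDegSeq {V : Type} (G : SimpleGraph V) {m : ℕ} (a : Fin m → ℕ) : Prop :=
  Antitone a ∧ ∃ e : Fin m ≃ V, ∀ i, a i = deg G (e i)

theorem adjMat_apply' {V : Type} [Fintype V] (G : SimpleGraph V) (i j : V) :
    adjMat G i j = open Classical in if G.Adj i j then 1 else 0 := by
  classical
  simp only [adjMat, SimpleGraph.adjMatrix_apply]

theorem specRad_rayleigh {V : Type} [Fintype V] [DecidableEq V] (G : SimpleGraph V) (y : V → ℝ) :
    y ⬝ᵥ (adjMat G).mulVec y ≤ specRad G * (y ⬝ᵥ y) := by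
  set A := adjMat G with hA
  set μ := specRad G with hμ
  have hB : ((algebraMap ℝ (Matrix V V ℝ) μ) - A).IsHermitian := by
    apply Matrix.IsHermitian.sub _ (adjMat_herm G)
    rw [Matrix.algebraMap_eq_diagonal]
    exact Matrix.isHermitian_diagonal _
  have hps : ((algebraMap ℝ (Matrix V V ℝ) μ) - A).PosSemidef := by
    rw [hB.posSemidef_iff_eigenvalues_nonneg]
    intro i
    have h1 := hB.eigenvalues_mem_spectrum_real i
    rw [← spectrum.singleton_sub_eq, Set.singleton_sub,
      (adjMat_herm G).spectrum_real_eq_range_eigenvalues] at h1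
    obtain ⟨_, ⟨j, rfl⟩, h2⟩ := h1
    have h3 : (adjMat_herm G).eigenvalues j ≤ μ :=
      le_ciSup (Set.finite_range _).bddAbove j
    show (0:ℝ) ≤ _
    rw [← h2]
    dsimp only
    linarith
  have := hps.dotProduct_mulVec_nonneg y
  rw [Matrix.sub_mulVec, dotProduct_sub, Algebra.algebraMap_eq_smul_one, Matrix.smul_mulVec,
    Matrix.one_mulVec, dotProduct_smul] at this
  simpa using this

theorem specRad_eigvec {V : Type} [Fintype V] [DecidableEq V] [Nonempty V] (G : SimpleGraph V) :
    ∃ x : V → ℝ, x ≠ 0 ∧ (adjMat G).mulVec x = specRad G • x := by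
  obtain ⟨i, hi⟩ := exists_eq_ciSup_of_finite (f := (adjMat_herm G).eigenvalues)
  refine ⟨(adjMat_herm G).eigenvectorBasis i, ?_, ?_⟩
  · intro h
    apply (adjMat_herm G).eigenvectorBasis.orthonormal.ne_zero i
    ext j
    exact congrFun h j
  · rw [(adjMat_herm G).mulVec_eigenvectorBasis i, hi]
    rfl

theorem bil_bound {ι : Type} [Fintype ι] (N : ℕ) (hN : Fintype.card ι ≤ N)
    (B : Matrix ι ι ℝ) (hB : ∀ i j, |B i j| ≤ 1) (u w : ι → ℝ) (U W : ℝ) (hU : 0 ≤ U) (hW : 0 ≤ W)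
    (hu : ∀ i, |u i| ≤ U) (hw : ∀ i, |w i| ≤ W) :
    |u ⬝ᵥ B.mulVec w| ≤ N ^ 2 * (U * W) := by
  have h1 : ∀ i, |B.mulVec w i| ≤ N * W := by
    intro i
    calc |B.mulVec w i| = |∑ j, B i j * w j| := rfl
      _ ≤ ∑ j, |B i j * w j| := Finset.abs_sum_le_sum_abs _ _
      _ ≤ ∑ j : ι, W := by
        apply Finset.sum_le_sum
        intro j _
        rw [abs_mul]
        have := mul_le_mul (hB i j) (hw j) (abs_nonneg _) zero_le_one
        linarith
      _ ≤ N * W := by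
        simp only [Finset.sum_const, Finset.card_univ, nsmul_eq_mul]
        gcongr
  calc |u ⬝ᵥ B.mulVec w| = |∑ i, u i * B.mulVec w i| := rfl
      _ ≤ ∑ j, |u j * B.mulVec w j| := Finset.abs_sum_le_sum_abs _ _
      _ ≤ ∑ j : ι, U * (N * W) := by
        apply Finset.sum_le_sum
        intro j _
        rw [abs_mul]
        exact mul_le_mul (hu j) (h1 j) (abs_nonneg _) hU
      _ ≤ N * (U * (N * W)) := by
        simp only [Finset.sum_const, Finset.card_univ, nsmul_eq_mul]
        gcongr
      _ = N ^ 2 * (U * W) := by ring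

theorem mulVec_bound {ι : Type} [Fintype ι] (N : ℕ) (hN : Fintype.card ι ≤ N)
    (B : Matrix ι ι ℝ) (hB : ∀ i j, |B i j| ≤ 1) (w : ι → ℝ) (W : ℝ) (hW : 0 ≤ W)
    (hw : ∀ i, |w i| ≤ W) (i : ι) : |B.mulVec w i| ≤ N * W := by
  calc |B.mulVec w i| = |∑ j, B i j * w j| := rfl
      _ ≤ ∑ j, |B i j * w j| := Finset.abs_sum_le_sum_abs _ _
      _ ≤ ∑ j : ι, W := by
        apply Finset.sum_le_sum
        intro j _
        rw [abs_mul]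
        have := mul_le_mul (hB i j) (hw j) (abs_nonneg _) zero_le_one
        linarith
      _ ≤ N * W := by
        simp only [Finset.sum_const, Finset.card_univ, nsmul_eq_mul]
        gcongr

theorem symm_dot {ι : Type} [Fintype ι] (B : Matrix ι ι ℝ) (hB : ∀ i j, B i j = B j i)
    (u w : ι → ℝ) : u ⬝ᵥ B.mulVec w = w ⬝ᵥ B.mulVec u := by
  have : B.transpose = B := by ext i j; exact hB j i
  rw [Matrix.dotProduct_mulVec, ← Matrix.mulVec_transpose, this, dotProduct_comm]

theorem analytic {ι : Type} [Fintype ι] (N : ℕ) (hN : Fintype.card ι ≤ N)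
    (A A' : Matrix ι ι ℝ) (hA0 : ∀ i j, 0 ≤ A i j) (hA1 : ∀ i j, A i j ≤ 1)
    (hA0' : ∀ i j, 0 ≤ A' i j) (hA1' : ∀ i j, A' i j ≤ 1)
    (hs : ∀ i j, A i j = A j i) (hs' : ∀ i j, A' i j = A' j i)
    (x : ι → ℝ) (ρ : ℝ) (hρ : 13 * (N : ℝ) ^ 4 + 2 * N + 1 < ρ)
    (hx : ∀ v, ρ * x v = 1 + A.mulVec x v)
    (hsum : ∑ v, A'.mulVec 1 v = ∑ v, A.mulVec 1 v)
    (hsq : ∑ v, (A.mulVec 1 v) ^ 2 + 1 ≤ ∑ v, (A'.mulVec 1 v) ^ 2) :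
    ∃ δ : ι → ℝ, 0 < x ⬝ᵥ (A' - A).mulVec x + 2 * (δ ⬝ᵥ (A' - A).mulVec x)
      + δ ⬝ᵥ A'.mulVec δ - ρ * (δ ⬝ᵥ δ) := by
  have hNr : (0 : ℝ) ≤ N := Nat.cast_nonneg N
  have hN4 : (0 : ℝ) ≤ (N : ℝ) ^ 4 := by positivity
  have hρ0 : 0 < ρ := by linarith
  have hAa : ∀ i j, |A i j| ≤ 1 := fun i j => abs_le.2 ⟨by linarith [hA0 i j], hA1 i j⟩
  have hAa' : ∀ i j, |A' i j| ≤ 1 := fun i j => abs_le.2 ⟨by linarith [hA0' i j], hA1' i j⟩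
  set D := A' - A with hD
  have hDa : ∀ i j, |D i j| ≤ 1 := fun i j => by
    rw [hD, Matrix.sub_apply]
    exact abs_le.2 ⟨by linarith [hA0' i j, hA1 i j], by linarith [hA1' i j, hA0 i j]⟩
  have hDs : ∀ i j, D i j = D j i := fun i j => by
    rw [hD, Matrix.sub_apply, Matrix.sub_apply, hs, hs']
  set d := A.mulVec 1 with hd
  set d' := A'.mulVec 1 with hd'
  set e := D.mulVec 1 with he
  have hed : e = d' - d := by rw [he, hD, Matrix.sub_mulVec]
  -- the scaled vector
  set z : ι → ℝ := ρ • x with hz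
  have hxz : x = ρ⁻¹ • z := by
    rw [hz, smul_smul, inv_mul_cancel₀ hρ0.ne', one_smul]
  set w : ι → ℝ := z - 1 with hw
  have hzw : z = 1 + w := by rw [hw]; abel
  have hwA : ρ • w = A.mulVec z := by
    ext v
    have := hx v
    simp only [hw, hz, Matrix.mulVec_smul, Pi.smul_apply, Pi.sub_apply, Pi.one_apply, smul_eq_mul]
    rw [this]; ring
  have hz2 : ∀ v, |z v| ≤ 2 := by
    intro v
    haveI : Nonempty ι := ⟨v⟩
    obtain ⟨v0, hv0⟩ := Finite.exists_max (fun v => |z v|)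
    refine (hv0 v).trans ?_
    have h1 := mulVec_bound N hN A hAa z (|z v0|) (abs_nonneg _) hv0 v0
    have h2 : ρ * z v0 = ρ + A.mulVec z v0 := by
      have := congrFun hwA v0
      simp only [hw, Pi.smul_apply, Pi.sub_apply, Pi.one_apply, smul_eq_mul] at this
      linarith
    have h3 : ρ * |z v0| ≤ ρ + N * |z v0| := by
      calc ρ * |z v0| = |ρ * z v0| := by rw [abs_mul, abs_of_pos hρ0]
        _ = |ρ + A.mulVec z v0| := by rw [h2]
        _ ≤ |ρ| + |A.mulVec z v0| := abs_add_le _ _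
        _ ≤ _ := by rw [abs_of_pos hρ0]; linarith
    by_contra hcon
    push Not at hcon
    nlinarith
  have hw2 : ∀ v, |w v| ≤ 2 * N / ρ := by
    intro v
    rw [le_div_iff₀ hρ0]
    have h1 := mulVec_bound N hN A hAa z 2 (by norm_num) hz2 v
    rw [← hwA, Pi.smul_apply, smul_eq_mul, abs_mul, abs_of_pos hρ0] at h1
    linarith
  have hW0 : 0 ≤ 2 * N / ρ := by positivity
  have he1 : ∀ v, |e v| ≤ N := by
    intro v
    have := mulVec_bound N hN D hDa 1 1 (by norm_num) (by simp) v
    simpa using this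
  have hAw : ρ • w = d + A.mulVec w := by
    rw [hwA, hzw, Matrix.mulVec_add]
  have h1D1 : (1 : ι → ℝ) ⬝ᵥ e = 0 := by
    rw [hed]
    simp only [dotProduct, Pi.one_apply, one_mul, Pi.sub_apply, Finset.sum_sub_distrib]
    linarith
  have hew : ρ * (e ⬝ᵥ w) = e ⬝ᵥ d + e ⬝ᵥ A.mulVec w := by
    rw [← dotProduct_add, ← hAw, dotProduct_smul, smul_eq_mul]
  have hzDz : z ⬝ᵥ D.mulVec z = 2 * (e ⬝ᵥ w) + w ⬝ᵥ D.mulVec w := by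
    rw [hzw, Matrix.mulVec_add, dotProduct_add, add_dotProduct, add_dotProduct, ← he, h1D1,
      symm_dot D hDs 1 w, ← he, dotProduct_comm w e]
    ring
  have heDz : e ⬝ᵥ D.mulVec z = e ⬝ᵥ e + e ⬝ᵥ D.mulVec w := by
    rw [hzw, Matrix.mulVec_add, dotProduct_add]
  have b1 := abs_le.1 (bil_bound N hN A hAa e w N (2 * N / ρ) hNr hW0 he1 hw2)
  have b2 := abs_le.1 (bil_bound N hN D hDa w w (2 * N / ρ) (2 * N / ρ) hW0 hW0 hw2 hw2)
  have b3 := abs_le.1 (bil_bound N hN D hDa e w N (2 * N / ρ) hNr hW0 he1 hw2)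
  have b4 := abs_le.1 (bil_bound N hN A' hAa' e e N N hNr hNr he1 he1)
  have hkey : 1 ≤ 2 * (e ⬝ᵥ d) + e ⬝ᵥ e := by
    have : 2 * (e ⬝ᵥ d) + e ⬝ᵥ e = ∑ v, (d' v) ^ 2 - ∑ v, (d v) ^ 2 := by
      simp only [dotProduct, hed, Finset.mul_sum, ← Finset.sum_add_distrib,
        ← Finset.sum_sub_distrib, Pi.sub_apply]
      apply Finset.sum_congr rfl
      intros; ring
    linarith
  refine ⟨(ρ ^ 2)⁻¹ • e, ?_⟩
  have hexp : x ⬝ᵥ D.mulVec x + 2 * (((ρ ^ 2)⁻¹ • e) ⬝ᵥ D.mulVec x)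
      + ((ρ ^ 2)⁻¹ • e) ⬝ᵥ A'.mulVec ((ρ ^ 2)⁻¹ • e)
      - ρ * (((ρ ^ 2)⁻¹ • e) ⬝ᵥ ((ρ ^ 2)⁻¹ • e)) =
      (ρ ^ 3)⁻¹ * (2 * (e ⬝ᵥ d) + e ⬝ᵥ e + (2 * (e ⬝ᵥ A.mulVec w) + ρ * (w ⬝ᵥ D.mulVec w)
        + 2 * (e ⬝ᵥ D.mulVec w) + ρ⁻¹ * (e ⬝ᵥ A'.mulVec e))) := by
    have h5 : e ⬝ᵥ d = ρ * (e ⬝ᵥ w) - e ⬝ᵥ A.mulVec w := by linarith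
    rw [hxz]
    simp only [Matrix.mulVec_smul, dotProduct_smul, smul_dotProduct, smul_eq_mul]
    rw [hzDz, heDz, h5]
    field_simp
    ring
  rw [hexp]
  apply mul_pos (by positivity)
  have c1 : (N : ℝ) ^ 2 * (N * (2 * N / ρ)) = 2 * (N ^ 4 / ρ) := by ring
  have c2 : ρ * ((N : ℝ) ^ 2 * (2 * N / ρ * (2 * N / ρ))) = 4 * (N ^ 4 / ρ) := by
    field_simp; ring
  have c4 : ρ⁻¹ * ((N : ℝ) ^ 2 * (N * N)) = N ^ 4 / ρ := by
    field_simp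
  have b2' := mul_le_mul_of_nonneg_left b2.1 hρ0.le
  have b4' := mul_le_mul_of_nonneg_left b4.1 (inv_pos.2 hρ0).le
  rw [mul_neg, c2] at b2'
  rw [mul_neg, c4] at b4'
  rw [c1] at b1 b3
  have hfin : 13 * ((N : ℝ) ^ 4 / ρ) < 1 := by
    rw [← mul_div_assoc, div_lt_one hρ0]
    linarith
  linarith [b1.1, b3.1]

theorem abel_nonneg (m : ℕ) (a b : ℕ → ℝ) (ha : ∀ i, a (i + 1) ≤ a i) (ha0 : ∀ i, 0 ≤ a i)
    (hb : ∀ k, 0 ≤ ∑ i ∈ Finset.range k, b i) :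
    0 ≤ ∑ i ∈ Finset.range m, a i * b i := by
  have key : ∀ k, a k * ∑ i ∈ Finset.range (k + 1), b i ≤
      ∑ i ∈ Finset.range (k + 1), a i * b i := by
    intro k
    induction k with
    | zero => simp
    | succ k ih =>
      rw [Finset.sum_range_succ _ (k + 1), Finset.sum_range_succ _ (k + 1)]
      have := mul_le_mul_of_nonneg_right (ha k) (hb (k + 1))
      linarith
  cases m with
  | zero => simp
  | succ k => exact (mul_nonneg (ha0 k) (hb _)).trans (key k)

theorem sq_lt_of_major (m : ℕ) (a a' : Fin m → ℕ) (ha : Antitone a)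
    (hmaj : ∀ k : ℕ, ∑ i ∈ Finset.univ.filter (fun i : Fin m => (i : ℕ) < k), a i ≤
                      ∑ i ∈ Finset.univ.filter (fun i : Fin m => (i : ℕ) < k), a' i)
    (hne : a ≠ a') : ∑ i, (a i) ^ 2 + 1 ≤ ∑ i, (a' i) ^ 2 := by
  let f : ℕ → ℝ := fun i => if h : i < m then a ⟨i, h⟩ else 0
  let g : ℕ → ℝ := fun i => if h : i < m then (a' ⟨i, h⟩ : ℝ) - a ⟨i, h⟩ else 0
  have hpre : ∀ k, ∑ i ∈ Finset.range k, g i =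
      ∑ i ∈ Finset.univ.filter (fun i : Fin m => (i : ℕ) < k), ((a' i : ℝ) - a i) := by
    intro k
    symm
    rw [← Finset.sum_filter_add_sum_filter_not (Finset.range k) (fun i => i < m)]
    rw [Finset.sum_eq_zero (s := Finset.filter (fun i => ¬ i < m) _), add_zero]
    · apply Finset.sum_bij (fun (i : Fin m) _ => (i : ℕ))
      · intro i hi; simp at hi ⊢; exact hi
      · intro i _ j _ h; exact Fin.ext h
      · intro j hj
        simp at hj
        exact ⟨⟨j, hj.2⟩, by simpa using hj.1, rfl⟩
      · intro i _; simp [g]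
    · intro i hi
      simp at hi
      simp [g, hi.2]
  have h1 := abel_nonneg m f g (by
      intro i
      simp only [f]
      by_cases h : i + 1 < m
      · rw [dif_pos h, dif_pos (by omega)]
        have hle : (⟨i, by omega⟩ : Fin m) ≤ ⟨i + 1, h⟩ := by
          rw [Fin.mk_le_mk]; omega
        exact_mod_cast ha hle
      · rw [dif_neg h]; split_ifs <;> positivity)
    (by intro i; simp only [f]; split_ifs <;> positivity)
    (by
      intro k
      rw [hpre, Finset.sum_sub_distrib, sub_nonneg]
      exact_mod_cast hmaj k)
  have h2 : ∑ i ∈ Finset.range m, f i * g i = ∑ i, (a i : ℝ) * ((a' i : ℝ) - a i) := by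
    rw [Finset.sum_range]
    simp [f, g]
  have h3 : 0 < ∑ i, ((a' i : ℝ) - a i) ^ 2 := by
    obtain ⟨i, hi⟩ := Function.ne_iff.1 hne
    apply Finset.sum_pos' (fun i _ => sq_nonneg _)
    refine ⟨i, Finset.mem_univ _, ?_⟩
    apply sq_pos_of_ne_zero
    rw [sub_ne_zero]
    exact_mod_cast hi.symm
  have h4 : ∑ i, (a' i : ℝ) ^ 2 - ∑ i, (a i : ℝ) ^ 2 =
      ∑ i, ((a' i : ℝ) - a i) ^ 2 + 2 * ∑ i, (a i : ℝ) * ((a' i : ℝ) - a i) := by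
    rw [Finset.mul_sum, ← Finset.sum_add_distrib, ← Finset.sum_sub_distrib]
    apply Finset.sum_congr rfl
    intros; ring
  have h5 : ∑ i, (a i : ℝ) ^ 2 < ∑ i, (a' i : ℝ) ^ 2 := by linarith
  exact_mod_cast h5

/-- Minor with all branch sets inside `T`. -/
def MinorIn {α β : Type} (H : SimpleGraph α) (G : SimpleGraph β) (T : Set β) : Prop :=
  ∃ φ : α → Set β,
    (∀ a, φ a ⊆ T) ∧
    (∀ a, (G.induce (φ a)).Connected) ∧
    (Pairwise fun a b => Disjoint (φ a) (φ b)) ∧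
    (∀ a b, H.Adj a b → ∃ x ∈ φ a, ∃ y ∈ φ b, G.Adj x y)

theorem MinorIn.mono {α β : Type} {H : SimpleGraph α} {G G' : SimpleGraph β} {T T' : Set β}
    (h : MinorIn H G T) (hT : T ⊆ T') (hG : ∀ u ∈ T, ∀ v ∈ T, G.Adj u v → G'.Adj u v) :
    MinorIn H G' T' := by
  obtain ⟨φ, h1, h2, h3, h4⟩ := h
  refine ⟨φ, fun a => (h1 a).trans hT, fun a => ?_, h3, fun a b hab => ?_⟩
  · refine (h2 a).mono ?_
    intro u v huv
    exact hG _ (h1 a u.2) _ (h1 a v.2) huv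
  · obtain ⟨x, hx, y, hy, hxy⟩ := h4 a b hab
    exact ⟨x, hx, y, hy, hG _ (h1 a hx) _ (h1 b hy) hxy⟩

theorem MinorIn.toMinorOf {α β γ : Type} {H : SimpleGraph α} {G : SimpleGraph β}
    {G1 : SimpleGraph γ} (f : γ → β) {T : Set β} (hT : T ⊆ Set.range f)
    (hf : ∀ x y, G.Adj (f x) (f y) → G1.Adj x y) (hinj : Function.Injective f)
    (h : MinorIn H G T) : MinorOf H G1 := by
  obtain ⟨φ, h1, h2, h3, h4⟩ := h
  have hc : ∀ z : β, z ∈ T → ∃ w, f w = z := fun z hz => hT hz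
  choose g hg using hc
  refine ⟨fun a => f ⁻¹' (φ a), fun a => ?_, fun a b hab => ?_, fun a b hab => ?_⟩
  · let F : G.induce (φ a) →g G1.induce (f ⁻¹' (φ a)) :=
      { toFun := fun z => ⟨g z.1 (h1 a z.2), by
          show f _ ∈ φ a
          rw [hg]; exact z.2⟩
        map_rel' := by
          intro u v huv
          apply hf
          show G.Adj (f (g _ _)) (f (g _ _))
          rw [hg, hg]
          exact huv }
    refine (h2 a).map F ?_
    intro z
    refine ⟨⟨f z.1, z.2⟩, ?_⟩
    apply Subtype.ext
    apply hinj
    exact hg _ _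
  · exact (h3 hab).preimage f
  · obtain ⟨x, hx, y, hy, hxy⟩ := h4 a b hab
    refine ⟨g x (h1 a hx), ?_, g y (h1 b hy), ?_, ?_⟩
    · show f _ ∈ φ a
      rw [hg]; exact hx
    · show f _ ∈ φ b
      rw [hg]; exact hy
    · apply hf
      rw [hg, hg]; exact hxy

theorem minor_join {V : Type} [Fintype V] (s t a b : ℕ) (G : SimpleGraph V)
    (K : Finset V) (hK : K.card = s - 1) (hcl : G.IsClique (↑K : Set V))
    (hdom : ∀ v : V, v ∉ K → ∀ u ∈ K, G.Adj u v)
    (ha : 1 ≤ a) (has : a ≤ s) (hab : a + b = t + 1)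
    (h : MinorIn (completeBipartiteGraph (Fin a) (Fin b)) G (↑K : Set V)ᶜ) :
    MinorOf (completeBipartiteGraph (Fin s) (Fin t)) G := by
  classical
  obtain ⟨φ, h1, h2, h3, h4⟩ := h
  let es : Fin s ≃ Fin a ⊕ Fin (s - a) := (finCongr (by omega)).trans finSumFinEquiv.symm
  let et : Fin t ≃ Fin b ⊕ Fin (a - 1) := (finCongr (by omega)).trans finSumFinEquiv.symm
  let eK : Fin (s - a) ⊕ Fin (a - 1) ≃ K := Fintype.equivOfCardEq (by simp [hK]; omega)
  let ψ : (Fin a ⊕ Fin b) ⊕ (Fin (s - a) ⊕ Fin (a - 1)) → Set V :=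
    Sum.elim φ (fun k => {(eK k : V)})
  let j : (Fin a ⊕ Fin (s - a)) ⊕ (Fin b ⊕ Fin (a - 1)) →
      (Fin a ⊕ Fin b) ⊕ (Fin (s - a) ⊕ Fin (a - 1)) := Equiv.sumSumSumComm _ _ _ _
  have hj : Function.Injective j := Equiv.injective _
  have hψc : ∀ p, (G.induce (ψ p)).Connected := by
    rintro (p | p)
    · exact h2 p
    · have : Subsingleton (ψ (Sum.inr p)) := by
        simp only [ψ, Sum.elim_inr]; infer_instance
      have : Nonempty (ψ (Sum.inr p)) := ⟨⟨eK p, rfl⟩⟩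
      exact ⟨SimpleGraph.Preconnected.of_subsingleton⟩
  have hψd : Pairwise fun p q => Disjoint (ψ p) (ψ q) := by
    rintro (p | p) (q | q) hpq
    · exact h3 (fun h => hpq (by rw [h]))
    · simp only [ψ, Sum.elim_inr, Sum.elim_inl, Set.disjoint_singleton_right]
      intro hh
      exact h1 p hh (eK q).2
    · simp only [ψ, Sum.elim_inr, Sum.elim_inl, Set.disjoint_singleton_left]
      intro hh
      exact h1 q hh (eK p).2
    · simp only [ψ, Sum.elim_inr, Set.disjoint_singleton]
      intro hh
      exact hpq (by rw [eK.injective (Subtype.ext hh)])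
  have hne : ∀ p, (φ p).Nonempty := fun p => by
    obtain ⟨x⟩ := (h2 p).nonempty
    exact ⟨x.1, x.2⟩
  -- adjacency between left and right
  have hadj : ∀ (p : Fin a ⊕ Fin (s - a)) (q : Fin b ⊕ Fin (a - 1)),
      ∃ x ∈ ψ (j (Sum.inl p)), ∃ y ∈ ψ (j (Sum.inr q)), G.Adj x y := by
    rintro (p | p) (q | q)
    · exact h4 (Sum.inl p) (Sum.inr q) (by simp)
    · obtain ⟨x, hx⟩ := hne (Sum.inl p)
      exact ⟨x, hx, eK (Sum.inr q), rfl, (hdom x (h1 _ hx) _ (eK (Sum.inr q)).2).symm⟩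
    · obtain ⟨x, hx⟩ := hne (Sum.inr q)
      exact ⟨eK (Sum.inl p), rfl, x, hx, hdom x (h1 _ hx) _ (eK (Sum.inl p)).2⟩
    · refine ⟨eK (Sum.inl p), rfl, eK (Sum.inr q), rfl, hcl (eK _).2 (eK _).2 ?_⟩
      intro hh
      have := eK.injective (Subtype.ext hh)
      simp at this
  let F : Fin s ⊕ Fin t → (Fin a ⊕ Fin (s - a)) ⊕ (Fin b ⊕ Fin (a - 1)) := Sum.map es et
  have hF : Function.Injective F := Sum.map_injective.2 ⟨es.injective, et.injective⟩
  refine ⟨fun p => ψ (j (F p)), fun p => hψc _, fun p q hpq => hψd ?_, ?_⟩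
  · exact fun h => hpq (hF (hj h))
  · rintro (p | p) (q | q) hpq
    · simp at hpq
    · exact hadj (es p) (et q)
    · obtain ⟨x, hx, y, hy, hxy⟩ := hadj (es q) (et p)
      exact ⟨y, hy, x, hx, hxy.symm⟩
    · simp at hpq

theorem minor_unjoin {V : Type} (s t : ℕ) (hst : s ≤ t) (G : SimpleGraph V)
    (K : Finset V) (hK : K.card = s - 1) (hs : 1 ≤ s)
    (h : MinorOf (completeBipartiteGraph (Fin s) (Fin t)) G) :
    ∃ a b : ℕ, 1 ≤ a ∧ 1 ≤ b ∧ a + b = t + 1 ∧ a ≤ min s ((t + 1) / 2) ∧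
      MinorIn (completeBipartiteGraph (Fin a) (Fin b)) G (↑K : Set V)ᶜ := by
  classical
  obtain ⟨φ, h2, h3, h4⟩ := h
  let good : Fin s ⊕ Fin t → Prop := fun p => φ p ⊆ (↑K : Set V)ᶜ
  have hbad : (Finset.univ.filter (fun p => ¬ good p)).card ≤ K.card := by
    have : ∀ p, ∃ v, v ∈ φ p ∧ (¬ good p → v ∈ K) := by
      intro p
      by_cases hp : good p
      · obtain ⟨x⟩ := (h2 p).nonempty
        exact ⟨x.1, x.2, fun h => absurd hp h⟩
      · have hp' := hp
        simp only [good, Set.not_subset] at hp'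
        obtain ⟨v, hv, hv'⟩ := hp'
        exact ⟨v, hv, fun _ => by simpa using hv'⟩
    choose g hg1 hg2 using this
    apply Finset.card_le_card_of_injOn g
    · intro p hp
      simp at hp
      exact hg2 p hp
    · intro p hp q hq hpq
      simp at hp hq
      by_contra hne
      exact Set.disjoint_left.1 (h3 hne) (hg1 p) (hpq ▸ hg1 q)
  let P : Finset (Fin s) := Finset.univ.filter (fun i => good (Sum.inl i))
  let Q : Finset (Fin t) := Finset.univ.filter (fun i => good (Sum.inr i))
  have hPQ : t + 1 ≤ P.card + Q.card := by
    have h5 := Finset.card_filter_add_card_filter_not (s := (Finset.univ : Finset (Fin s ⊕ Fin t))) good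
    have h6 : (Finset.univ.filter (fun p => good p)).card = P.card + Q.card := by
      rw [← Finset.card_disjSum]
      congr 1
      ext (x | x) <;> simp [P, Q]
    simp only [Finset.card_univ, Fintype.card_sum, Fintype.card_fin] at h5
    rw [h6] at h5
    omega
  have hPs : P.card ≤ s := by simpa using Finset.card_le_univ P
  have hQt : Q.card ≤ t := by simpa using Finset.card_le_univ Q
  -- choose sizes
  obtain ⟨p, q, hp1, hq1, hpq, hpP, hqQ⟩ : ∃ p q, 1 ≤ p ∧ 1 ≤ q ∧ p + q = t + 1 ∧ p ≤ P.card ∧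
      q ≤ Q.card := ⟨t + 1 - Q.card, Q.card, by omega, by omega, by omega, by omega, le_rfl⟩
  let fP : Fin p → Fin s := fun i => P.orderEmbOfFin rfl (Fin.castLE hpP i)
  let fQ : Fin q → Fin t := fun i => Q.orderEmbOfFin rfl (Fin.castLE hqQ i)
  have hfP : Function.Injective fP := fun i j hij => by
    simpa [fP] using hij
  have hfQ : Function.Injective fQ := fun i j hij => by
    simpa [fQ] using hij
  have gP : ∀ i, good (Sum.inl (fP i)) := fun i => by
    have : fP i ∈ P := Finset.orderEmbOfFin_mem _ _ _
    simpa [P] using this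
  have gQ : ∀ i, good (Sum.inr (fQ i)) := fun i => by
    have : fQ i ∈ Q := Finset.orderEmbOfFin_mem _ _ _
    simpa [Q] using this
  by_cases hle : p ≤ (t + 1) / 2
  · refine ⟨p, q, hp1, hq1, hpq, le_min (by omega) hle, fun x => φ (Sum.map fP fQ x), ?_,
      fun x => h2 _, ?_, ?_⟩
    · rintro (x | x)
      · exact gP x
      · exact gQ x
    · intro x y hxy
      exact h3 (fun hh => hxy (Sum.map_injective.2 ⟨hfP, hfQ⟩ hh))
    · rintro (x | x) (y | y) hxy
      · simp at hxy
      · exact h4 _ _ (by simp)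
      · exact h4 _ _ (by simp)
      · simp at hxy
  · refine ⟨q, p, hq1, hp1, by omega, le_min (by omega) (by omega),
      fun x => φ (Sum.map fP fQ x.swap), ?_, fun x => h2 _, ?_, ?_⟩
    · rintro (x | x)
      · exact gQ x
      · exact gP x
    · intro x y hxy
      apply h3
      intro hh
      have := Sum.map_injective.2 ⟨hfP, hfQ⟩ hh
      exact hxy (Sum.swap_leftInverse.injective this)
    · rintro (x | x) (y | y) hxy
      · simp at hxy
      · exact h4 _ _ (by simp)
      · exact h4 _ _ (by simp)
      · simp at hxy

theorem minor_split {V : Type} (a b : ℕ) (ha : 1 ≤ a) (hb : 1 ≤ b) (G : SimpleGraph V)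
    (T S : Set V) (hTS : ∀ u ∈ T, ∀ v ∈ T, G.Adj u v → (u ∈ S ↔ v ∈ S))
    (h : MinorIn (completeBipartiteGraph (Fin a) (Fin b)) G T) :
    MinorIn (completeBipartiteGraph (Fin a) (Fin b)) G S ∨
    MinorIn (completeBipartiteGraph (Fin a) (Fin b)) G (T \ S) := by
  obtain ⟨φ, h1, h2, h3, h4⟩ := h
  have hin : ∀ p, ∀ x ∈ φ p, ∀ y ∈ φ p, (x ∈ S ↔ y ∈ S) := by
    intro p x hx y hy
    obtain ⟨w⟩ := (h2 p).preconnected ⟨x, hx⟩ ⟨y, hy⟩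
    have : ∀ (u v : φ p), (G.induce (φ p)).Walk u v → (u.1 ∈ S ↔ v.1 ∈ S) := by
      intro u v w
      induction w with
      | nil => rfl
      | @cons u v _ huv _ ih =>
        exact (hTS _ (h1 p u.2) _ (h1 p v.2) huv).trans ih
    exact this _ _ w
  have hadj : ∀ p q, (completeBipartiteGraph (Fin a) (Fin b)).Adj p q →
      ∀ x ∈ φ p, ∀ y ∈ φ q, (x ∈ S ↔ y ∈ S) := by
    intro p q hpq x hx y hy
    obtain ⟨x', hx', y', hy', hxy⟩ := h4 p q hpq
    exact ((hin p x hx x' hx').trans (hTS _ (h1 p hx') _ (h1 q hy') hxy)).trans (hin q y' hy' y hy)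
  have hne : ∀ p, (φ p).Nonempty := fun p => by
    obtain ⟨x⟩ := (h2 p).nonempty
    exact ⟨x.1, x.2⟩
  obtain ⟨x0, hx0⟩ := hne (Sum.inl ⟨0, ha⟩)
  obtain ⟨y0, hy0⟩ := hne (Sum.inr ⟨0, hb⟩)
  have hall : ∀ p, ∀ x ∈ φ p, (x0 ∈ S ↔ x ∈ S) := by
    rintro (p | p) x hx
    · exact (hadj (Sum.inl ⟨0, ha⟩) (Sum.inr ⟨0, hb⟩) (by simp) x0 hx0 y0 hy0).trans
        (hadj (Sum.inr ⟨0, hb⟩) (Sum.inl p) (by simp) y0 hy0 x hx)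
    · exact hadj (Sum.inl ⟨0, ha⟩) (Sum.inr p) (by simp) x0 hx0 x hx
  by_cases hx : x0 ∈ S
  · left
    exact ⟨φ, fun p x hxp => (hall p x hxp).1 hx, h2, h3, h4⟩
  · right
    exact ⟨φ, fun p x hxp => ⟨h1 p hxp, fun h => hx ((hall p x hxp).2 h)⟩, h2, h3, h4⟩

theorem star_minor {V : Type} (t : ℕ) (G : SimpleGraph V) (T : Set V) (v : V) (hv : v ∈ T)
    (F : Finset V) (hF : ∀ w ∈ F, w ∈ T ∧ G.Adj v w) (hc : t ≤ F.card) :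
    MinorIn (completeBipartiteGraph (Fin 1) (Fin t)) G T := by
  classical
  let f : Fin t → V := fun i => (F.equivFin.symm (Fin.castLE hc i) : V)
  have hf : Function.Injective f := fun i j hij => by
    have := F.equivFin.symm.injective (Subtype.ext hij)
    simpa using this
  have hfF : ∀ i, f i ∈ F := fun i => (F.equivFin.symm _).2
  refine ⟨Sum.elim (fun _ => {v}) (fun i => {f i}), ?_, ?_, ?_, ?_⟩
  · rintro (p | p)
    · simpa using hv
    · simpa using (hF _ (hfF p)).1
  · rintro (p | p)
    · have : Subsingleton ((Sum.elim (fun _ => {v}) (fun i => {f i}) :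
        Fin 1 ⊕ Fin t → Set V) (Sum.inl p)) := by
        simp only [Sum.elim_inl]; infer_instance
      have : Nonempty ((Sum.elim (fun _ => {v}) (fun i => {f i}) :
        Fin 1 ⊕ Fin t → Set V) (Sum.inl p)) := ⟨⟨v, rfl⟩⟩
      exact ⟨SimpleGraph.Preconnected.of_subsingleton⟩
    · have : Subsingleton ((Sum.elim (fun _ => {v}) (fun i => {f i}) :
        Fin 1 ⊕ Fin t → Set V) (Sum.inr p)) := by
        simp only [Sum.elim_inr]; infer_instance
      have : Nonempty ((Sum.elim (fun _ => {v}) (fun i => {f i}) :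
        Fin 1 ⊕ Fin t → Set V) (Sum.inr p)) := ⟨⟨f p, rfl⟩⟩
      exact ⟨SimpleGraph.Preconnected.of_subsingleton⟩
  · rintro (p | p) (q | q) hpq
    · exact absurd (by rw [Subsingleton.elim p q]) hpq
    · simpa using (hF _ (hfF q)).2.ne
    · simpa using (hF _ (hfF p)).2.ne'
    · simp only [Sum.elim_inr, Set.disjoint_singleton]
      exact fun h => hpq (by rw [hf h])
  · rintro (p | p) (q | q) hpq
    · simp at hpq
    · exact ⟨v, rfl, f q, rfl, (hF _ (hfF q)).2⟩
    · exact ⟨f p, rfl, v, rfl, (hF _ (hfF p)).2.symm⟩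
    · simp at hpq

theorem specRad_large {V : Type} [Fintype V] [DecidableEq V] (G : SimpleGraph V) (u : V)
    (hu : ∀ v, v ≠ u → G.Adj u v) (R : ℝ) (hR : 0 ≤ R) (hR2 : R ^ 2 + 1 ≤ Fintype.card V) :
    R ≤ specRad G := by
  classical
  let y : V → ℝ := fun v => if v = u then R else 1
  have hcard : ((Finset.univ.erase u).card : ℝ) = Fintype.card V - 1 := by
    rw [Finset.card_erase_of_mem (Finset.mem_univ _), Finset.card_univ, Nat.cast_sub]
    · simp
    · exact Fintype.card_pos_iff.2 ⟨u⟩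
  set n1 : ℝ := Fintype.card V - 1 with hn1
  have hyu : y u = R := by simp [y]
  have hyv : ∀ v ∈ Finset.univ.erase u, y v = 1 := fun v hv => by
    simp [y, (Finset.mem_erase.1 hv).1]
  have hy0 : ∀ v, 0 ≤ y v := fun v => by simp only [y]; split_ifs <;> linarith
  have hyy : y ⬝ᵥ y = R ^ 2 + n1 := by
    rw [dotProduct, ← Finset.add_sum_erase _ _ (Finset.mem_univ u), hyu,
      Finset.sum_congr rfl (fun v hv => by rw [hyv v hv])]
    simp only [mul_one, Finset.sum_const, nsmul_eq_mul]
    rw [hcard]; ring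
  have hAu : (adjMat G).mulVec y u = n1 := by
    rw [Matrix.mulVec, dotProduct, ← Finset.add_sum_erase _ _ (Finset.mem_univ u),
      Finset.sum_congr rfl (fun v hv => by
        rw [hyv v hv, adjMat_apply', if_pos (hu v (Finset.mem_erase.1 hv).1)])]
    simp only [mul_one, Finset.sum_const, nsmul_eq_mul]
    rw [hcard, adjMat_apply']; simp
  have hAv : ∀ v ∈ Finset.univ.erase u, R ≤ (adjMat G).mulVec y v := by
    intro v hv
    have h0 : ∀ w ∈ (Finset.univ : Finset V), 0 ≤ adjMat G v w * y w := fun w _ => by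
      apply mul_nonneg _ (hy0 w)
      rw [adjMat_apply']; split_ifs <;> norm_num
    have := Finset.single_le_sum h0 (Finset.mem_univ u)
    rw [adjMat_apply', if_pos (hu v (Finset.mem_erase.1 hv).1).symm, hyu, one_mul] at this
    exact this
  have hyAy : 2 * R * n1 ≤ y ⬝ᵥ (adjMat G).mulVec y := by
    rw [dotProduct, ← Finset.add_sum_erase _ _ (Finset.mem_univ u), hyu, hAu]
    have : ∑ v ∈ Finset.univ.erase u, R ≤
        ∑ v ∈ Finset.univ.erase u, y v * (adjMat G).mulVec y v := by
      apply Finset.sum_le_sum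
      intro v hv
      rw [hyv v hv, one_mul]
      exact hAv v hv
    simp only [Finset.sum_const, nsmul_eq_mul] at this
    rw [hcard] at this
    linarith
  have hray := specRad_rayleigh G y
  rw [hyy] at hray
  have hn1R : R ^ 2 ≤ n1 := by rw [hn1]; linarith
  by_contra hcon
  push Not at hcon
  have hRpos : 0 ≤ n1 := le_trans (sq_nonneg R) hn1R
  rcases hRpos.eq_or_lt with h | h
  · have : R ^ 2 = 0 := le_antisymm (by linarith) (sq_nonneg R)
    have hR0 : R = 0 := by simpa using this
    -- degenerate case: a negative largest eigenvalue contradicts the trace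
    rw [hn1] at h
    have hy1 := specRad_rayleigh G (Pi.single u 1)
    rw [single_one_dotProduct, single_one_dotProduct, Matrix.mulVec_single_one] at hy1
    simp [adjMat_apply'] at hy1
    linarith
  · have : R * (R ^ 2 + n1) ≤ 2 * R * n1 := by nlinarith
    have h2 : specRad G * (R ^ 2 + n1) < R * (R ^ 2 + n1) := by
      apply mul_lt_mul_of_pos_right hcon; positivity
    linarith

theorem exists_norm_eigvec {V : Type} [Fintype V] [DecidableEq V] [Nonempty V]
    (G : SimpleGraph V) (K : Finset V)
    (hcl : G.IsClique (↑K : Set V)) (hdom : ∀ v : V, v ∉ K → ∀ u ∈ K, G.Adj u v) (t : ℕ)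
    (hdeg : ∀ v ∉ K, ∀ F : Finset V, (∀ w ∈ F, w ∉ K ∧ G.Adj v w) → F.card ≤ t)
    (hρ : (t : ℝ) < specRad G) :
    ∃ x : V → ℝ, (adjMat G).mulVec x = specRad G • x ∧ ∑ u ∈ K, x u = 1 := by
  classical
  obtain ⟨x, hx0, hx⟩ := specRad_eigvec G
  set ρ := specRad G
  have ht0 : (0 : ℝ) ≤ t := Nat.cast_nonneg t
  have hxv : ∀ v, ρ * x v = ∑ w ∈ K, adjMat G v w * x w + ∑ w ∈ Kᶜ, adjMat G v w * x w := by
    intro v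
    have := congrFun hx v
    rw [Pi.smul_apply, smul_eq_mul] at this
    rw [← this, Finset.sum_add_sum_compl]
    rfl
  by_cases hc : ∑ u ∈ K, x u = 0
  · exfalso
    have hL : ∀ v ∉ K, x v = 0 := by
      intro v hv
      obtain ⟨v0, hv0, hmax⟩ := Finset.exists_max_image Kᶜ (fun v => |x v|)
        ⟨v, by simpa using hv⟩
      have hv0K : v0 ∉ K := by simpa using hv0
      have h1 := hxv v0
      have h2 : ∑ w ∈ K, adjMat G v0 w * x w = 0 := by
        rw [← hc]
        apply Finset.sum_congr rfl
        intro w hw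
        rw [adjMat_apply', if_pos (hdom v0 hv0K w hw).symm, one_mul]
      rw [h2, zero_add] at h1
      have h3 : |∑ w ∈ Kᶜ, adjMat G v0 w * x w| ≤ t * |x v0| := by
        calc |∑ w ∈ Kᶜ, adjMat G v0 w * x w| ≤ ∑ w ∈ Kᶜ, |adjMat G v0 w * x w| :=
              Finset.abs_sum_le_sum_abs _ _
          _ ≤ ∑ w ∈ Kᶜ, if G.Adj v0 w then |x v0| else 0 := by
              apply Finset.sum_le_sum
              intro w hw
              rw [adjMat_apply']
              split_ifs
              · rw [one_mul]; exact hmax w hw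
              · simp
          _ = (Finset.filter (fun w => G.Adj v0 w) Kᶜ).card * |x v0| := by
              rw [← Finset.sum_filter, Finset.sum_const, nsmul_eq_mul]
          _ ≤ t * |x v0| := by
              gcongr
              apply hdeg v0 hv0K
              intro w hw
              simpa using hw
      rw [← h1, abs_mul, abs_of_pos (by linarith)] at h3
      have h4 : |x v0| = 0 := by
        by_contra hne
        have : 0 < |x v0| := lt_of_le_of_ne (abs_nonneg _) (Ne.symm hne)
        nlinarith
      have h5 := hmax v (by simpa using hv)
      rw [h4] at h5
      exact abs_eq_zero.1 (le_antisymm h5 (abs_nonneg _))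
    apply hx0
    ext u
    by_cases hu : u ∈ K
    · have h1 := hxv u
      rw [Finset.sum_eq_zero (s := Kᶜ) (fun w hw => by rw [hL w (by simpa using hw), mul_zero]),
        add_zero] at h1
      rw [← Finset.add_sum_erase _ _ hu] at h1 hc
      have h2 : ∑ w ∈ K.erase u, adjMat G u w * x w = ∑ w ∈ K.erase u, x w := by
        apply Finset.sum_congr rfl
        intro w hw
        rw [Finset.mem_erase] at hw
        rw [adjMat_apply', if_pos (hcl hu hw.2 hw.1.symm), one_mul]
      rw [h2, adjMat_apply', if_neg (G.loopless.irrefl u)] at h1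
      have h3 : (ρ + 1) * x u = 0 := by linarith
      rcases mul_eq_zero.1 h3 with h | h
      · linarith
      · exact h
    · exact hL u hu
  · refine ⟨(∑ u ∈ K, x u)⁻¹ • x, ?_, ?_⟩
    · rw [Matrix.mulVec_smul, hx, smul_comm]
    · simp only [Pi.smul_apply, smul_eq_mul, ← Finset.mul_sum]
      exact inv_mul_cancel₀ hc

theorem dot_restrict {V ι : Type} [Fintype V] [Fintype ι] (f : ι → V)
    (hf : Function.Injective f) (B : Matrix V V ℝ) (p q : V → ℝ)
    (h : ∀ u v, ¬ (u ∈ Set.range f ∧ v ∈ Set.range f) → p u * (B u v * q v) = 0) :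
    p ⬝ᵥ B.mulVec q = (p ∘ f) ⬝ᵥ (B.submatrix f f).mulVec (q ∘ f) := by
  simp only [dotProduct, Matrix.mulVec, Finset.mul_sum, Matrix.submatrix_apply,
    Function.comp_apply]
  symm
  apply Fintype.sum_of_injective f hf
  · intro u hu
    exact Finset.sum_eq_zero fun v _ => h u v (fun h => hu h.1)
  · intro i
    apply Fintype.sum_of_injective f hf
    · intro v hv
      exact h _ v (fun h => hv h.2)
    · intro j; rfl

theorem specRad_lt {V ι : Type} [Fintype V] [DecidableEq V] [Fintype ι] (N : ℕ)
    (hN : Fintype.card ι ≤ N) (G G' : SimpleGraph V) (f : ι → V) (hf : Function.Injective f)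
    (hout : ∀ u v, ¬ (u ∈ Set.range f ∧ v ∈ Set.range f) → (G.Adj u v ↔ G'.Adj u v))
    (x : V → ℝ) (hx : (adjMat G).mulVec x = specRad G • x)
    (hxS : ∀ i, specRad G * x (f i) = 1 + (adjMat (G.comap f)).mulVec (x ∘ f) i)
    (hρ : 13 * (N : ℝ) ^ 4 + 2 * N + 1 < specRad G)
    (hsum : ∑ v, (adjMat (G'.comap f)).mulVec 1 v = ∑ v, (adjMat (G.comap f)).mulVec 1 v)
    (hsq : ∑ v, ((adjMat (G.comap f)).mulVec 1 v) ^ 2 + 1 ≤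
      ∑ v, ((adjMat (G'.comap f)).mulVec 1 v) ^ 2) :
    specRad G < specRad G' := by
  classical
  have h0 : ∀ {W : Type} [Fintype W] (J : SimpleGraph W) (i j : W), 0 ≤ adjMat J i j := by
    intro W _ J i j
    rw [adjMat_apply']; split_ifs <;> norm_num
  have h1 : ∀ {W : Type} [Fintype W] (J : SimpleGraph W) (i j : W), adjMat J i j ≤ 1 := by
    intro W _ J i j
    rw [adjMat_apply']; split_ifs <;> norm_num
  have hsy : ∀ {W : Type} [Fintype W] (J : SimpleGraph W) (i j : W),
      adjMat J i j = adjMat J j i := by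
    intro W _ J i j
    rw [adjMat_apply', adjMat_apply']; simp only [J.adj_comm]
  obtain ⟨δ, hδ⟩ := analytic N hN (adjMat (G.comap f)) (adjMat (G'.comap f)) (h0 _) (h1 _) (h0 _)
    (h1 _) (hsy _) (hsy _) (x ∘ f) (specRad G) hρ hxS hsum hsq
  set ρ := specRad G with hρdef
  let δ' : V → ℝ := Function.extend f δ 0
  have hδf : δ' ∘ f = δ := by ext i; exact hf.extend_apply _ _ _
  have hδo : ∀ u, u ∉ Set.range f → δ' u = 0 := fun u hu => by
    simp only [δ']
    rw [Function.extend_apply' _ _ _ (fun ⟨a, ha⟩ => hu ⟨a, ha⟩)]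
    rfl
  set A := adjMat G with hA
  set A' := adjMat G' with hA'
  set D := A' - A with hD
  have hsubA : A.submatrix f f = adjMat (G.comap f) := by
    ext i j
    rw [Matrix.submatrix_apply, hA, adjMat_apply', adjMat_apply']; rfl
  have hsubA' : A'.submatrix f f = adjMat (G'.comap f) := by
    ext i j
    rw [Matrix.submatrix_apply, hA', adjMat_apply', adjMat_apply']; rfl
  have hsubD : D.submatrix f f = adjMat (G'.comap f) - adjMat (G.comap f) := by
    rw [← hsubA, ← hsubA']; rfl
  have hDo : ∀ u v, ¬ (u ∈ Set.range f ∧ v ∈ Set.range f) → D u v = 0 := by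
    intro u v huv
    rw [hD, Matrix.sub_apply, hA, hA', adjMat_apply', adjMat_apply']
    simp only [hout u v huv, sub_self]
  have e1 : x ⬝ᵥ D.mulVec x = _ := dot_restrict f hf D x x
    (fun u v h => by rw [hDo u v h]; ring)
  have e2 : δ' ⬝ᵥ D.mulVec x = _ := dot_restrict f hf D δ' x
    (fun u v h => by rw [hDo u v h]; ring)
  have e3 : δ' ⬝ᵥ A'.mulVec δ' = _ := dot_restrict f hf A' δ' δ' (fun u v h => by
    by_cases hu : u ∈ Set.range f
    · rw [hδo v (fun hv => h ⟨hu, hv⟩)]; ring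
    · rw [hδo u hu]; ring)
  have e4 : δ' ⬝ᵥ δ' = δ ⬝ᵥ δ := by
    rw [← hδf]
    symm
    apply Fintype.sum_of_injective f hf
    · intro u hu
      rw [hδo u hu, zero_mul]
    · intro i; rfl
  rw [hsubD] at e1 e2
  rw [hsubA'] at e3
  rw [hδf] at e2 e3
  rw [← e1, ← e2, ← e3, ← e4] at hδ
  have hA'x : A'.mulVec x = ρ • x + D.mulVec x := by
    rw [← hx, ← Matrix.add_mulVec, hD, add_sub_cancel]
  have hq : (x + δ') ⬝ᵥ A'.mulVec (x + δ') - ρ * ((x + δ') ⬝ᵥ (x + δ')) =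
      x ⬝ᵥ D.mulVec x + 2 * (δ' ⬝ᵥ D.mulVec x) + δ' ⬝ᵥ A'.mulVec δ' - ρ * (δ' ⬝ᵥ δ') := by
    rw [Matrix.mulVec_add, dotProduct_add, add_dotProduct, add_dotProduct,
      symm_dot A' (hsy G') x δ', hA'x, dotProduct_add, dotProduct_add, dotProduct_smul,
      dotProduct_smul, dotProduct_add, add_dotProduct, add_dotProduct, smul_eq_mul, smul_eq_mul,
      dotProduct_comm x δ']
    ring
  have hray := specRad_rayleigh G' (x + δ')
  have hyy : 0 ≤ (x + δ') ⬝ᵥ (x + δ') := Finset.sum_nonneg fun i _ => mul_self_nonneg _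
  by_contra hcon
  push Not at hcon
  have := mul_le_mul_of_nonneg_right hcon hyy
  linarith

theorem deg_eq_mulVec {V : Type} [Fintype V] (H : SimpleGraph V) (v : V) :
    (adjMat H).mulVec 1 v = (deg H v : ℝ) := by
  classical
  rw [deg, Set.ncard_eq_toFinset_card']
  simp only [Matrix.mulVec, dotProduct, adjMat_apply', Pi.one_apply, mul_one]
  rw [Finset.sum_boole]
  congr 2
  ext w; simp

/-- Lemma 2.8 (local degree sequence majorization). -/
theorem local_degree_majorization (s t N : ℕ) (hs : 2 ≤ s) (hst : s ≤ t) :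
    ∃ n₀ : ℕ, ∀ n : ℕ, n₀ ≤ n →
    ∀ (G : SimpleGraph (Fin n)) (K : Finset (Fin n)),
      ¬ MinorOf (completeBipartiteGraph (Fin s) (Fin t)) G →
      (∀ G' : SimpleGraph (Fin n),
        ¬ MinorOf (completeBipartiteGraph (Fin s) (Fin t)) G' → specRad G' ≤ specRad G) →
      K.card = s - 1 → G.IsClique (↑K : Set (Fin n)) →
      (∀ v : Fin n, v ∉ K → ∀ u ∈ K, G.Adj u v) →
      ∀ S : Set {v : Fin n // v ∉ K},
        (∀ u v : {v : Fin n // v ∉ K},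
          (G.comap (Subtype.val : {v : Fin n // v ∉ K} → Fin n)).Reachable u v →
            (u ∈ S ↔ v ∈ S)) →
        S.ncard ≤ N →
        ∀ H' : SimpleGraph ↥S, HasSTProp s t H' →
          ecard H' = ecard ((G.comap (Subtype.val : {v : Fin n // v ∉ K} → Fin n)).induce S) →
          ∀ (m : ℕ) (a a' : Fin m → ℕ),
            IsDegSeq ((G.comap (Subtype.val : {v : Fin n // v ∉ K} → Fin n)).induce S) a →
            IsDegSeq H' a' →
            (∀ k : ℕ, ∑ i ∈ Finset.univ.filter (fun i : Fin m => (i : ℕ) < k), a i ≤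
                      ∑ i ∈ Finset.univ.filter (fun i : Fin m => (i : ℕ) < k), a' i) →
            (∑ i, a i = ∑ i, a' i) →
            a = a' := by
  classical
  set R : ℕ := 13 * N ^ 4 + 2 * N + 2 + t with hR
  refine ⟨R ^ 2 + 1, ?_⟩
  intro n hn G K hfree hext hKc hcl hdom S hS hSN H' hH' _ m a a' hda hda' hmaj hsumaa
  by_contra hne
  obtain ⟨hanti, e, he⟩ := hda
  obtain ⟨_, e', he'⟩ := hda'
  have hsq := sq_lt_of_major m a a' hanti hmaj hne
  have : Fintype ↥S := Fintype.ofFinite _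
  have hcard : Fintype.card ↥S ≤ N := by
    rw [← Nat.card_eq_fintype_card, Nat.card_coe_set_eq]; exact hSN
  have : Nonempty (Fin n) := ⟨⟨0, by omega⟩⟩
  let f : ↥S → Fin n := fun v => v.1.1
  have hf : Function.Injective f := fun u v h => Subtype.ext (Subtype.ext h)
  have hfK : ∀ i, f i ∉ K := fun i => i.1.2
  -- the modified graph
  let G' : SimpleGraph (Fin n) :=
    { Adj := fun u v => (∃ i j, f i = u ∧ f j = v ∧ H'.Adj i j) ∨
        (G.Adj u v ∧ ¬ (u ∈ Set.range f ∧ v ∈ Set.range f))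
      symm := ⟨by
        rintro u v (⟨i, j, h1, h2, h3⟩ | ⟨h1, h2⟩)
        · exact Or.inl ⟨j, i, h2, h1, h3.symm⟩
        · exact Or.inr ⟨h1.symm, fun h => h2 ⟨h.2, h.1⟩⟩⟩
      loopless := ⟨by
        rintro u (⟨i, j, h1, h2, h3⟩ | ⟨h1, h2⟩)
        · exact h3.ne (hf (h1.trans h2.symm))
        · exact G.loopless.irrefl u h1⟩ }
  have hG'f : ∀ i j, G'.Adj (f i) (f j) ↔ H'.Adj i j := by
    intro i j
    constructor
    · rintro (⟨i', j', h1, h2, h3⟩ | ⟨h1, h2⟩)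
      · rwa [hf h1, hf h2] at h3
      · exact absurd ⟨⟨i, rfl⟩, ⟨j, rfl⟩⟩ h2
    · exact fun h => Or.inl ⟨i, j, rfl, rfl, h⟩
  have hout : ∀ u v, ¬ (u ∈ Set.range f ∧ v ∈ Set.range f) → (G.Adj u v ↔ G'.Adj u v) := by
    intro u v huv
    constructor
    · exact fun h => Or.inr ⟨h, huv⟩
    · rintro (⟨i', j', h1, h2, h3⟩ | ⟨h1, h2⟩)
      · exact absurd ⟨⟨i', h1⟩, ⟨j', h2⟩⟩ huv
      · exact h1
  have hcomp : ∀ u ∉ K, ∀ v ∉ K, G.Adj u v → (u ∈ Set.range f ↔ v ∈ Set.range f) := by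
    intro u hu v hv huv
    have h1 := hS ⟨u, hu⟩ ⟨v, hv⟩ (SimpleGraph.Adj.reachable (by exact huv))
    have h2 : ∀ w (hw : w ∉ K), w ∈ Set.range f ↔ (⟨w, hw⟩ : {v : Fin n // v ∉ K}) ∈ S := by
      intro w hw
      constructor
      · rintro ⟨i, rfl⟩; exact i.2
      · exact fun h => ⟨⟨_, h⟩, rfl⟩
    rw [h2 u hu, h2 v hv]; exact h1
  have hnoL : ∀ a b : ℕ, 1 ≤ a → a ≤ s → a + b = t + 1 →
      ¬ MinorIn (completeBipartiteGraph (Fin a) (Fin b)) G (↑K : Set (Fin n))ᶜ :=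
    fun a b h1 h2 h3 h => hfree (minor_join s t a b G K hKc hcl hdom h1 h2 h3 h)
  have hG'free : ¬ MinorOf (completeBipartiteGraph (Fin s) (Fin t)) G' := by
    intro hmin
    obtain ⟨p, q, hp, hq, hpq, hple, hin⟩ := minor_unjoin s t hst G' K hKc (by omega) hmin
    have hsp := minor_split p q hp hq G' (↑K : Set (Fin n))ᶜ (Set.range f) (by
      intro u hu v hv huv
      by_cases h : u ∈ Set.range f ∧ v ∈ Set.range f
      · simp only [h.1, h.2]
      · exact hcomp u hu v hv ((hout u v h).2 huv)) hin
    rcases hsp with h | h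
    · exact hH' p q hp hq hpq hple
        (h.toMinorOf f le_rfl (fun i j => (hG'f i j).1) hf)
    · refine hnoL p q hp (hple.trans (min_le_left _ _)) hpq (h.mono Set.sdiff_subset ?_)
      intro u hu v hv huv
      exact (hout u v (fun hh => hu.2 hh.1)).2 huv
  have hdeg : ∀ v ∉ K, ∀ F : Finset (Fin n), (∀ w ∈ F, w ∉ K ∧ G.Adj v w) → F.card ≤ t := by
    intro v hv F hF
    by_contra hlt
    push Not at hlt
    exact hnoL 1 t le_rfl (by omega) (by omega)
      (star_minor t G _ v hv F hF hlt.le)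
  obtain ⟨u, hu⟩ : K.Nonempty := by rw [← Finset.card_pos]; omega
  have hlarge : (R : ℝ) ≤ specRad G := by
    apply specRad_large G u _ R (Nat.cast_nonneg _)
    · rw [Fintype.card_fin]; exact_mod_cast hn
    · intro v hv
      by_cases hvK : v ∈ K
      · exact hcl hu hvK hv.symm
      · exact hdom v hvK u hu
  have hRr : (R : ℝ) = 13 * (N : ℝ) ^ 4 + 2 * N + 2 + t := by rw [hR]; push_cast; ring
  have hN4 : (0 : ℝ) ≤ (N : ℝ) ^ 4 := by positivity
  have hN0 : (0 : ℝ) ≤ (N : ℝ) := by positivity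
  have ht0 : (0 : ℝ) ≤ (t : ℝ) := by positivity
  obtain ⟨x, hx, hxK⟩ := exists_norm_eigvec G K hcl hdom t hdeg (by linarith)
  have hxS : ∀ i, specRad G * x (f i) = 1 + (adjMat (G.comap f)).mulVec (x ∘ f) i := by
    intro i
    have h1 := congrFun hx (f i)
    rw [Pi.smul_apply, smul_eq_mul] at h1
    rw [← h1]
    have h2 : (adjMat (G.comap f)).mulVec (x ∘ f) i = ∑ w ∈ Kᶜ, adjMat G (f i) w * x w := by
      have h3 : ∑ w ∈ Kᶜ, adjMat G (f i) w * x w =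
          ∑ w, if w ∈ K then 0 else adjMat G (f i) w * x w := by
        rw [Finset.compl_eq_univ_sdiff, Finset.sdiff_eq_filter, Finset.sum_filter]
        apply Finset.sum_congr rfl
        intro w _
        by_cases hw : w ∈ K <;> simp [hw]
      rw [h3]
      apply Fintype.sum_of_injective f hf
      · intro w hw
        split_ifs with hwK
        · rfl
        · rw [adjMat_apply', if_neg, zero_mul]
          intro hadj
          exact hw ((hcomp _ (hfK i) _ hwK hadj).1 ⟨i, rfl⟩)
      · intro j
        rw [if_neg (hfK j)]
        show adjMat (G.comap f) i j * x (f j) = _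
        rw [adjMat_apply', adjMat_apply']
        rfl
    rw [h2, ← hxK]
    show ∑ w, adjMat G (f i) w * x w = _
    rw [← Finset.sum_add_sum_compl K]
    congr 1
    apply Finset.sum_congr rfl
    intro w hw
    rw [adjMat_apply', if_pos (hdom _ (hfK i) w hw).symm, one_mul]
  have hcH : G.comap f =
      (G.comap (Subtype.val : {v : Fin n // v ∉ K} → Fin n)).induce S := rfl
  have hcH' : G'.comap f = H' := by
    ext i j; exact hG'f i j
  have hlt := specRad_lt N hcard G G' f hf hout x hx hxS (by linarith)
    (by
      rw [hcH', hcH]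
      simp only [deg_eq_mulVec]
      rw [← e'.sum_comp (fun v => (deg H' v : ℝ)), ← e.sum_comp (fun v => (deg (induce S (G.comap Subtype.val)) v : ℝ))]
      simp only [← he, ← he']
      exact_mod_cast hsumaa.symm)
    (by
      rw [hcH', hcH]
      simp only [deg_eq_mulVec]
      rw [← e'.sum_comp (fun v => (deg H' v : ℝ) ^ 2),
        ← e.sum_comp (fun v => (deg (induce S (G.comap Subtype.val)) v : ℝ) ^ 2)]
      simp only [← he, ← he']
      exact_mod_cast hsq)
  exact absurd (hext G' hG'free) (not_le.2 hlt)
end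

section
/- Let t ≥ 4, 2 ≤ s ≤ t, γ = min{s, ⌊(t+1)/2⌋}, and let G be a connected graph on t+1 vertices. Then G has the (s,t)-property if and only if every connected component of the complement \overline{G} has at least γ+1 vertices. -/
open SimpleGraph

/-- Lemma 3.1: (s,t)-property of a connected (t+1)-vertex graph via components of the complement. -/
theorem stprop_iff_complement_components (s t : ℕ) (ht : 4 ≤ t) (hs : 2 ≤ s) (hst : s ≤ t)
    {V : Type} [Fintype V] (hV : Fintype.card V = t + 1)
    (G : SimpleGraph V) (hconn : G.Connected) :
    HasSTProp s t G ↔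
      ∀ c : (Gᶜ).ConnectedComponent, min s ((t+1)/2) + 1 ≤ c.supp.ncard := by
  classical
  constructor
  · intro h c
    by_contra hc
    have hpos : 0 < c.supp.ncard := (Set.ncard_pos (Set.toFinite _)).2 c.nonempty_supp
    have hadd : c.supp.ncard + (c.supp)ᶜ.ncard = t + 1 := by
      rw [Set.ncard_add_ncard_compl, Nat.card_eq_fintype_card, hV]
    have hle : c.supp.ncard ≤ min s ((t+1)/2) := by omega
    have hle2 : c.supp.ncard ≤ (t+1)/2 := hle.trans (min_le_right _ _)
    refine h c.supp.ncard (c.supp)ᶜ.ncard hpos (by omega) hadd hle ?_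
    have e1 : Fin c.supp.ncard ≃ c.supp :=
      (finCongr (Nat.card_coe_set_eq _).symm).trans (Finite.equivFin c.supp).symm
    have e2 : Fin (c.supp)ᶜ.ncard ≃ ((c.supp)ᶜ : Set V) :=
      (finCongr (Nat.card_coe_set_eq _).symm).trans (Finite.equivFin ((c.supp)ᶜ : Set V)).symm
    have key : ∀ x ∈ c.supp, ∀ y ∉ c.supp, G.Adj x y := by
      intro x hx y hy
      by_contra hn
      have hne : x ≠ y := by rintro rfl; exact hy hx
      have hadj : Gᶜ.Adj x y := by
        rw [SimpleGraph.compl_adj]; exact ⟨hne, hn⟩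
      apply hy
      rw [SimpleGraph.ConnectedComponent.mem_supp_iff] at hx ⊢
      rw [← hx]
      exact SimpleGraph.ConnectedComponent.sound hadj.symm.reachable
    let f : Fin c.supp.ncard ⊕ Fin (c.supp)ᶜ.ncard → V :=
      Sum.elim (fun i => (e1 i : V)) (fun j => (e2 j : V))
    have hf : Function.Injective f := by
      rintro (i | i) (j | j) hij
      · exact congrArg Sum.inl (e1.injective (Subtype.ext hij))
      · exact absurd (e1 i).2 (by
          have h2 := (e2 j).2
          have h3 : (e1 i : V) = e2 j := hij
          rw [h3]; exact h2)
      · exact absurd (e1 j).2 (by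
          have h2 := (e2 i).2
          have h3 : (e2 i : V) = e1 j := hij
          rw [← h3]; exact h2)
      · exact congrArg Sum.inr (e2.injective (Subtype.ext hij))
    refine ⟨fun x => {f x}, ?_, ?_, ?_⟩
    · intro x
      haveI : Nonempty ({f x} : Set V) := ⟨⟨f x, rfl⟩⟩
      refine SimpleGraph.Connected.mk ?_
      intro u v
      have : u = v := Subsingleton.elim _ _
      rw [this]
    · intro x y hxy
      exact Set.disjoint_singleton.2 (fun h' => hxy (hf h'))
    · rintro (i | i) (j | j) hij
      · simp at hij
      · exact ⟨_, rfl, _, rfl, key _ (e1 i).2 _ (e2 j).2⟩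
      · exact ⟨_, rfl, _, rfl, (key _ (e1 j).2 _ (e2 i).2).symm⟩
      · simp at hij
  · rintro h a b ha hb hab hle ⟨φ, hφ, hd, hadj⟩
    have hne : ∀ x, ∃ v, v ∈ φ x := fun x => by
      obtain ⟨v⟩ := (hφ x).nonempty
      exact ⟨v.1, v.2⟩
    choose f hf using hne
    have huniq : ∀ x y v, v ∈ φ x → v ∈ φ y → x = y := by
      intro x y v hx hy
      by_contra hxy
      exact Set.disjoint_left.1 (hd hxy) hx hy
    have hinj : Function.Injective f := by
      intro x y hxy
      exact huniq x y (f x) (hf x) (hxy ▸ hf y)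
    have hbij : Function.Bijective f := by
      rw [Fintype.bijective_iff_injective_and_card]
      exact ⟨hinj, by simp [hV, hab]⟩
    have hsing : ∀ x v, v ∈ φ x → v = f x := by
      intro x v hv
      obtain ⟨z, rfl⟩ := hbij.2 v
      rw [huniq x z _ hv (hf z)]
    have hG : ∀ i j, G.Adj (f (Sum.inl i)) (f (Sum.inr j)) := by
      intro i j
      obtain ⟨x, hx, y, hy, hxy⟩ := hadj (Sum.inl i) (Sum.inr j) (by simp)
      rwa [hsing _ _ hx, hsing _ _ hy] at hxy
    let A : Set V := Set.range fun i : Fin a => f (Sum.inl i)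
    have hA : A.ncard ≤ a := by
      have := Set.ncard_image_le (f := fun i : Fin a => f (Sum.inl i)) (s := Set.univ)
      rwa [Set.image_univ, Set.ncard_univ, Nat.card_fin] at this
    have hstep : ∀ x y, Gᶜ.Adj x y → x ∈ A → y ∈ A := by
      rintro x y hxy ⟨i, rfl⟩
      obtain ⟨z | z, rfl⟩ := hbij.2 y
      · exact ⟨z, rfl⟩
      · rw [SimpleGraph.compl_adj] at hxy
        exact absurd (hG i z) hxy.2
    have hwalk : ∀ x y, Gᶜ.Walk x y → x ∈ A → y ∈ A := by
      intro x y p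
      induction p with
      | nil => exact id
      | cons hxy _ ih => exact fun hx => ih (hstep _ _ hxy hx)
    have hc := h (Gᶜ.connectedComponentMk (f (Sum.inl ⟨0, ha⟩)))
    have hsub : (Gᶜ.connectedComponentMk (f (Sum.inl ⟨0, ha⟩))).supp ⊆ A := by
      intro y hy
      rw [SimpleGraph.ConnectedComponent.mem_supp_iff] at hy
      obtain ⟨p⟩ := SimpleGraph.ConnectedComponent.exact hy
      exact hwalk _ _ p.reverse ⟨_, rfl⟩
    have := Set.ncard_le_ncard hsub (Set.toFinite _)
    omega
end

section
/- Let t ≥ 4, 2 ≤ s ≤ t, β = ⌊(t+1)/(s+1)⌋, and let G be a connected graph on t+1 vertices having the (s,t)-property. Then e(G) ≤ C(t,2) + β − 1, where C(t,2) = t(t−1)/2. -/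
open SimpleGraph

theorem card_le_edges_add_comps {V : Type} [Fintype V] [Nonempty V] (H : SimpleGraph V) :
    Fintype.card V ≤ H.edgeSet.ncard + Nat.card H.ConnectedComponent := by
  classical
  let r : H.ConnectedComponent → V := fun c => c.out
  have hr : ∀ c, H.connectedComponentMk (r c) = c := fun c => Quot.out_eq c
  let v0 : V := Classical.arbitrary V
  let c0 := H.connectedComponentMk v0
  let S : Set (Sym2 V) := (fun c => s(r c0, r c)) '' {c | c ≠ c0}
  let K : SimpleGraph V := SimpleGraph.fromEdgeSet (H.edgeSet ∪ S)
  have hHK : H ≤ K := by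
    intro a b hab
    simp only [K, SimpleGraph.fromEdgeSet_adj]
    exact ⟨Or.inl hab, hab.ne⟩
  have h1 : ∀ v, K.Reachable (r c0) v := by
    intro v
    have h2 : K.Reachable (r (H.connectedComponentMk v)) v :=
      (SimpleGraph.ConnectedComponent.exact (hr _)).mono hHK
    by_cases hc : H.connectedComponentMk v = c0
    · rw [← hc]; exact h2
    · refine SimpleGraph.Reachable.trans (SimpleGraph.Adj.reachable ?_) h2
      simp only [K, SimpleGraph.fromEdgeSet_adj]
      refine ⟨Or.inr ⟨_, hc, rfl⟩, fun h => hc ?_⟩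
      rw [← hr (H.connectedComponentMk v), ← h, hr]
  have hK : K.Connected :=
    { preconnected := fun a b => (h1 a).symm.trans (h1 b), nonempty := inferInstance }
  have h3 := hK.card_vert_le_card_edgeSet_add_one
  rw [Nat.card_eq_fintype_card, Nat.card_coe_set_eq] at h3
  have h4 : K.edgeSet.ncard ≤ H.edgeSet.ncard + S.ncard := by
    refine le_trans (Set.ncard_le_ncard ?_ (Set.toFinite _)) (Set.ncard_union_le _ _)
    rw [SimpleGraph.edgeSet_fromEdgeSet]
    exact Set.diff_subset
  have h5 : S.ncard ≤ ({c | c ≠ c0} : Set H.ConnectedComponent).ncard :=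
    Set.ncard_image_le (Set.toFinite _)
  have h6 : ({c | c ≠ c0} : Set H.ConnectedComponent).ncard + 1
      = Nat.card H.ConnectedComponent := by
    have h := Set.ncard_add_ncard_compl ({c0} : Set H.ConnectedComponent)
    rw [Set.ncard_singleton] at h
    have e : ({c | c ≠ c0} : Set H.ConnectedComponent) = {c0}ᶜ := by ext; simp
    rw [e]; omega
  omega

theorem ecard_add_compl {V : Type} [Fintype V] (G : SimpleGraph V) :
    G.edgeSet.ncard + Gᶜ.edgeSet.ncard = (Fintype.card V).choose 2 := by
  classical
  have hd : Disjoint G.edgeSet Gᶜ.edgeSet :=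
    SimpleGraph.disjoint_edgeSet.mpr disjoint_compl_right
  rw [← Set.ncard_union_eq hd (Set.toFinite _) (Set.toFinite _), ← SimpleGraph.edgeSet_sup,
    sup_compl_eq_top, ← SimpleGraph.card_edgeFinset_top_eq_card_choose_two,
    ← Set.ncard_coe_finset, SimpleGraph.coe_edgeFinset]

/-- a set with no complement edges leaving it yields a complete bipartite minor -/
theorem minor_of_set {V : Type} [Fintype V] (G : SimpleGraph V) (A : Set V) (a b : ℕ)
    (ha : A.ncard = a) (hb : Aᶜ.ncard = b) (h : ∀ x ∈ A, ∀ y ∉ A, G.Adj x y) :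
    MinorOf (completeBipartiteGraph (Fin a) (Fin b)) G := by
  classical
  let f : Fin a ≃ A := (Finite.equivFinOfCardEq (by rw [Nat.card_coe_set_eq, ha])).symm
  let g : Fin b ≃ (Aᶜ : Set V) := (Finite.equivFinOfCardEq (by rw [Nat.card_coe_set_eq, hb])).symm
  let p : Fin a ⊕ Fin b → V := Sum.elim (fun i => (f i : V)) (fun j => (g j : V))
  refine ⟨fun i => {p i}, fun i => ?_, ?_, ?_⟩
  · exact SimpleGraph.Connected.of_subsingleton
  · intro i j hij
    rw [Set.disjoint_singleton]
    intro hp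
    apply hij
    rcases i with i | i <;> rcases j with j | j <;> simp only [p, Sum.elim_inl, Sum.elim_inr] at hp
    · rw [f.injective (Subtype.ext hp)]
    · exact absurd (hp ▸ (f i).2) (g j).2
    · exact absurd (hp ▸ (f j).2) (g i).2
    · rw [g.injective (Subtype.ext hp)]
  · intro i j hij
    refine ⟨p i, rfl, p j, rfl, ?_⟩
    rcases i with i | i <;> rcases j with j | j <;> simp at hij
    · exact h _ (f i).2 _ (g j).2
    · exact (h _ (f j).2 _ (g i).2).symm

/-- Lemma 3.2: edge bound for connected (t+1)-vertex graphs with the (s,t)-property. -/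
theorem edge_bound_stprop (s t : ℕ) (ht : 4 ≤ t) (hs : 2 ≤ s) (hst : s ≤ t)
    {V : Type} [Fintype V] (hV : Fintype.card V = t + 1)
    (G : SimpleGraph V) (hconn : G.Connected) (hprop : HasSTProp s t G) :
    ecard G ≤ t.choose 2 + ((t+1)/(s+1) - 1) := by
  classical
  haveI := hconn.nonempty
  have hβ : 1 ≤ (t+1)/(s+1) := (Nat.one_le_div_iff (by omega)).mpr (by omega)
  have hN : Nat.card V = t + 1 := by rw [Nat.card_eq_fintype_card, hV]
  have hpos : ∀ c : Gᶜ.ConnectedComponent, 1 ≤ c.supp.ncard := fun c =>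
    (Set.ncard_pos (Set.toFinite _)).mpr c.nonempty_supp
  have hcomp : ∀ c : Gᶜ.ConnectedComponent, c.supp.ncard ≤ t → min s ((t+1)/2) < c.supp.ncard := by
    intro c hct
    by_contra hlt
    have hadd := Set.ncard_add_ncard_compl c.supp
    refine hprop c.supp.ncard c.suppᶜ.ncard (hpos c) (by omega) (by omega) (by omega)
      (minor_of_set G c.supp _ _ rfl rfl ?_)
    intro x hx y hy
    by_contra hxy
    apply hy
    have hne : x ≠ y := fun e => hy (e ▸ hx)
    have hadj : Gᶜ.Adj x y := (SimpleGraph.compl_adj G x y).mpr ⟨hne, hxy⟩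
    rw [SimpleGraph.ConnectedComponent.mem_supp_iff] at hx ⊢
    rw [← hx]
    exact (SimpleGraph.ConnectedComponent.sound hadj.reachable).symm
  have hdis : ∀ c d : Gᶜ.ConnectedComponent, c ≠ d → c.supp.ncard + d.supp.ncard ≤ t + 1 := by
    intro c d hcd
    rw [← Set.ncard_union_eq (SimpleGraph.pairwise_disjoint_supp_connectedComponent _ hcd)
      (Set.toFinite _) (Set.toFinite _), ← hN]
    exact Set.ncard_le_card _
  have hcard : Nat.card Gᶜ.ConnectedComponent ≤ (t+1)/(s+1) := by
    by_cases hsub : Subsingleton Gᶜ.ConnectedComponent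
    · exact le_trans (Finite.card_le_one_iff_subsingleton.mpr hsub) hβ
    · rw [not_subsingleton_iff_nontrivial] at hsub
      have hbig : ∀ c : Gᶜ.ConnectedComponent, s + 1 ≤ c.supp.ncard := by
        intro c
        obtain ⟨d, hd⟩ := exists_ne c
        have h1 := hdis c d hd.symm
        have h2 := hpos c
        have h3 := hpos d
        have h4 := hcomp c (by omega)
        have h5 := hcomp d (by omega)
        omega
      rw [Nat.le_div_iff_mul_le (by omega)]
      have hsum : ∑ c : Gᶜ.ConnectedComponent, c.supp.ncard = t + 1 := by
        rw [← hV, ← Finset.card_univ,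
          Finset.card_eq_sum_card_fiberwise (f := Gᶜ.connectedComponentMk) (t := Finset.univ)
            (by simp)]
        refine Finset.sum_congr rfl fun c _ => ?_
        rw [← Set.ncard_coe_finset]
        congr 1
        ext v
        simp
      rw [← hsum, Nat.card_eq_fintype_card, ← Finset.card_univ, ← smul_eq_mul]
      exact Finset.card_nsmul_le_sum _ _ _ fun c _ => hbig c
  have h1 := card_le_edges_add_comps Gᶜ
  have h2 := ecard_add_compl G
  rw [hV] at h1 h2
  have h3 : (t+1).choose 2 = t + t.choose 2 := by
    rw [Nat.choose_succ_succ' t 1, Nat.choose_one_right]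
  unfold ecard
  omega
end
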